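/- arXiv:1205.6762 — 9 statements merged into one kernel-verified Lean document; each statement's English description precedes it below -/
import Mathlib

section
/- Let L be a field, m, s ≥ 1, σ₁,…,σ_m pairwise commuting injective ring endomorphisms of L, and K a subfield of L with σᵢ(K) ⊆ K for all i. Let η₁,…,η_s ∈ L. Then there exists a polynomial φ ∈ ℚ[t] and integers a₀,…,a_m such that φ(t) = ∑_{i=0}^{m} a_i · C(t+i, i) (in particular deg φ ≤ m) and, for all sufficiently large r ∈ ℕ, φ(r) equals the transcendence degree over K of the subfield of L generated over K by the set {σ₁^{k₁}∘⋯∘σ_m^{k_m}(η_j) : k₁,…,k_m ∈ ℕ, k₁+⋯+k_m ≤ r, 1 ≤ j ≤ s}. -/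
open Polynomial

set_option synthInstance.maxHeartbeats 1000000
set_option maxHeartbeats 1000000

/-- The binomial polynomial `B_i(t) = (t+i)(t+i−1)⋯(t+1)/i!` in `ℚ[t]`. -/
noncomputable def binomialPoly (i : ℕ) : Polynomial ℚ :=
  Polynomial.C ((i.factorial : ℚ)⁻¹) *
    ∏ j ∈ Finset.range i, (Polynomial.X + Polynomial.C ((j : ℚ) + 1))

/-- Transcendence degree of the `K`-algebra `A`: the supremum of cardinalities
of algebraically independent subsets of `A` over `K`. -/
noncomputable def trdeg (K A : Type*) [CommRing K] [CommRing A] [Algebra K A] : Cardinal :=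
  ⨆ s : { s : Set A // AlgebraicIndependent K ((↑) : s → A) }, Cardinal.mk s.1

/-- `θ_k = σ₁^{k₁} ∘ ⋯ ∘ σ_m^{k_m}` for a family of endomorphisms `σ`. -/
def thetaApply {L : Type*} [Field L] {m : ℕ} (σ : Fin m → (L →+* L))
    (k : Fin m → ℕ) : L → L :=
  (List.ofFn fun i => (⇑(σ i))^[k i]).foldr (· ∘ ·) id


theorem dd_greedy {K L ι α : Type*} [Field K] [Field L] [Algebra K L] [LinearOrder α]
    (key : ι → α) (hkey : Function.Injective key) (x : ι → L) (D : Set ι)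
    (hD : ∀ i, i ∈ D ↔ IsAlgebraic (Algebra.adjoin K (x '' {j | key j < key i})) (x i))
    (n : ℕ) : ∀ T : Finset ι, T.card = n → (∀ i ∈ T, ∀ j, key j < key i → j ∈ T) →
      AlgebraicIndepOn K x ((T : Set ι) \ D) ∧
      ∀ i ∈ T, IsAlgebraic (Algebra.adjoin K (x '' ((T : Set ι) \ D))) (x i) := by
  classical
  induction n with
  | zero =>
    intro T hT _
    obtain rfl := Finset.card_eq_zero.mp hT
    refine ⟨?_, by simp⟩
    have : ((∅ : Finset ι) : Set ι) \ D = ∅ := by simp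
    rw [this]
    unfold AlgebraicIndepOn
    apply algebraicIndependent_empty_type
  | succ n ih =>
    intro T hT hlow
    have hne : T.Nonempty := by rw [← Finset.card_pos]; omega
    obtain ⟨i, hi, hmax⟩ := Finset.exists_max_image T key hne
    have hT'c : (T.erase i).card = n := by rw [Finset.card_erase_of_mem hi]; omega
    have hseg : ((T.erase i : Finset ι) : Set ι) = {j | key j < key i} := by
      ext j
      simp only [Finset.coe_erase, Set.mem_sdiff, Finset.mem_coe, Set.mem_singleton_iff,
        Set.mem_ofPred_eq]
      constructor
      · rintro ⟨h1, h2⟩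
        exact lt_of_le_of_ne (hmax j h1) (fun h => h2 (hkey h))
      · intro h
        exact ⟨hlow i hi j h, fun h' => by subst h'; exact lt_irrefl _ h⟩
    obtain ⟨h1, h2⟩ := ih (T.erase i) hT'c (by
      intro a ha j hj
      rw [Finset.mem_erase] at ha ⊢
      refine ⟨?_, hlow a ha.2 j hj⟩
      rintro rfl
      exact absurd hj (not_lt.mpr (hmax a ha.2)))
    have hTi : (T : Set ι) = insert i ((T.erase i : Finset ι) : Set ι) := by
      rw [← Finset.coe_insert, Finset.insert_erase hi]
    have hDi := hD i
    rw [← hseg] at hDi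
    have key2 : IsAlgebraic (Algebra.adjoin K (x '' ((T.erase i : Finset ι) : Set ι))) (x i) →
        IsAlgebraic (Algebra.adjoin K (x '' (((T.erase i : Finset ι) : Set ι) \ D))) (x i) := by
      intro h
      refine h.adjoin_of_forall_isAlgebraic ?_
      rintro _ ⟨⟨j, hj, rfl⟩, _⟩
      exact h2 j hj
    have mono : ∀ (s t : Set L), s ⊆ t → ∀ a : L, IsAlgebraic (Algebra.adjoin K s) a →
        IsAlgebraic (Algebra.adjoin K t) a := by
      intro s t hst a ha
      exact ha.adjoin_of_forall_isAlgebraic (fun y hy => absurd (hst hy.1) hy.2)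
    by_cases hiD : i ∈ D
    · have heq : (T : Set ι) \ D = ((T.erase i : Finset ι) : Set ι) \ D := by
        rw [hTi, Set.insert_sdiff_of_mem _ hiD]
      rw [heq]
      refine ⟨h1, ?_⟩
      intro j hj
      by_cases hji : j = i
      · subst hji
        exact key2 (hDi.mp hiD)
      · exact h2 j (Finset.mem_erase.mpr ⟨hji, hj⟩)
    · have heq : (T : Set ι) \ D = insert i (((T.erase i : Finset ι) : Set ι) \ D) := by
        rw [hTi, Set.insert_sdiff_of_notMem _ hiD]
      rw [heq]
      refine ⟨h1.insert ?_, ?_⟩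
      · intro h
        exact hiD (hDi.mpr (mono _ _ (Set.image_mono Set.sdiff_subset) _ h))
      · intro j hj
        by_cases hji : j = i
        · subst hji
          exact isAlgebraic_algebraMap (⟨x j, Algebra.subset_adjoin ⟨j, Set.mem_insert _ _, rfl⟩⟩ :
            Algebra.adjoin K (x '' _))
        · exact mono _ _ (Set.image_mono (Set.subset_insert _ _)) _
            (h2 j (Finset.mem_erase.mpr ⟨hji, hj⟩))

theorem dd_trdeg {K L ι : Type*} [Field K] [Field L] [Algebra K L]
    (x : ι → L) (T B : Set ι) (hBT : B ⊆ T) (hB : B.Finite)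
    (h1 : AlgebraicIndepOn K x B)
    (h2 : ∀ i ∈ T, IsAlgebraic (Algebra.adjoin K (x '' B)) (x i)) :
    trdeg K (IntermediateField.adjoin K (x '' T)) = (B.ncard : Cardinal) := by
  set E := IntermediateField.adjoin K (x '' T) with hE
  let y : B → E := fun b => ⟨x b, IntermediateField.subset_adjoin _ _ ⟨b, hBT b.2, rfl⟩⟩
  have hy : AlgebraicIndependent K y := by
    refine AlgebraicIndependent.of_comp E.val ?_
    exact h1
  have hb : IsTranscendenceBasis K y := by
    rw [hy.isTranscendenceBasis_iff_isAlgebraic]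
    refine ⟨fun e => ?_⟩
    have he : IsAlgebraic (Algebra.adjoin K (x '' T)) (e : L) := by
      rw [← IntermediateField.isAlgebraic_adjoin_iff]
      exact isAlgebraic_algebraMap (A := L) e
    have he2 : IsAlgebraic (Algebra.adjoin K (x '' B)) (e : L) := by
      refine he.adjoin_of_forall_isAlgebraic ?_
      rintro _ ⟨⟨j, hj, rfl⟩, _⟩
      exact h2 j hj
    have hmap : (Algebra.adjoin K (Set.range y)).map E.val = Algebra.adjoin K (x '' B) := by
      rw [AlgHom.map_adjoin, ← Set.range_comp]
      congr 1
      ext z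
      simp [y]
    rw [← hmap] at he2
    refine IsAlgebraic.of_ringHom_of_comp_eq
      ((Algebra.adjoin K (Set.range y)).equivMapOfInjective E.val E.val.injective).toRingEquiv.toRingHom
      E.val.toRingHom he2 ?_ ?_ ?_
    · exact ((Algebra.adjoin K (Set.range y)).equivMapOfInjective E.val E.val.injective).surjective
    · exact E.val.injective
    · ext z
      rfl
  have h := hb.lift_cardinalMk_eq_trdeg
  have h3 : trdeg K E = Algebra.trdeg K E := rfl
  rw [h3]
  have := hB.to_subtype
  have h4 : Cardinal.mk B = (B.ncard : Cardinal) := by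
    rw [← Set.cast_ncard hB]
  rw [h4] at h
  simpa using h.symm

theorem dd_theta_comm {L : Type*} [Field L] {m : ℕ} (σ : Fin m → (L →+* L)) (τ : L →+* L)
    (h : ∀ i, τ.comp (σ i) = (σ i).comp τ) (k : Fin m → ℕ) (y : L) :
    τ (thetaApply σ k y) = thetaApply σ k (τ y) := by
  induction m with
  | zero => simp [thetaApply]
  | succ m ih =>
    have e : ∀ z, thetaApply σ k z =
        (⇑(σ 0))^[k 0] (thetaApply (fun i => σ i.succ) (fun i => k i.succ) z) := by
      intro z; simp [thetaApply, List.ofFn_succ]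
    rw [e, e, ← ih (fun i => σ i.succ) (fun i => h i.succ)]
    have hc : Function.Commute (⇑τ) (⇑(σ 0)) := fun z => RingHom.congr_fun (h 0) z
    exact (hc.iterate_right (k 0)) _

theorem dd_theta_succ {L : Type*} [Field L] {m : ℕ} (σ : Fin m → (L →+* L))
    (h : ∀ i j, (σ i).comp (σ j) = (σ j).comp (σ i)) (k : Fin m → ℕ) (i : Fin m) (y : L) :
    thetaApply σ (k + Pi.single i 1) y = σ i (thetaApply σ k y) := by
  induction m with
  | zero => exact i.elim0
  | succ m ih =>
    have e : ∀ k z, thetaApply σ k z =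
        (⇑(σ 0))^[k 0] (thetaApply (fun i => σ i.succ) (fun i => k i.succ) z) := by
      intro k z; simp [thetaApply, List.ofFn_succ]
    rw [e, e]
    induction i using Fin.cases with
    | zero =>
      have : (fun i : Fin m => (k + Pi.single 0 1 : Fin (m+1) → ℕ) i.succ) = fun i => k i.succ := by
        ext j; simp
      rw [this]
      simp [Function.iterate_succ_apply']
    | succ i =>
      have : (fun j : Fin m => (k + Pi.single i.succ 1 : Fin (m+1) → ℕ) j.succ)
          = (fun j => k j.succ) + Pi.single i 1 := by
        ext j; simp [Pi.single_apply]
      rw [this, ih (fun i => σ i.succ) (fun a b => h _ _)]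
      have hc : Function.Commute (⇑(σ i.succ)) (⇑(σ 0)) := fun z => RingHom.congr_fun (h _ _) z
      simpa using ((hc.iterate_right (k 0)) _).symm

theorem dd_shift {L : Type*} [Field L] (K : Subfield L) (τ : L →+* L)
    (hK : ∀ x ∈ K, τ x ∈ K) (S S' : Set L) (hS : ∀ z ∈ S, τ z ∈ S') (y : L)
    (hy : IsAlgebraic (Algebra.adjoin K S) y) : IsAlgebraic (Algebra.adjoin K S') (τ y) := by
  have hmem : ∀ z ∈ Algebra.adjoin K S, τ z ∈ Algebra.adjoin K S' := by
    intro z hz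
    induction hz using Algebra.adjoin_induction with
    | mem z hz => exact Algebra.subset_adjoin (hS z hz)
    | algebraMap r =>
      exact (Algebra.adjoin K S').algebraMap_mem (⟨τ r, hK _ r.2⟩ : K)
    | add a b _ _ ha hb => rw [map_add]; exact add_mem ha hb
    | mul a b _ _ ha hb => rw [map_mul]; exact mul_mem ha hb
  let f : Algebra.adjoin K S →+* Algebra.adjoin K S' :=
    { toFun := fun z => ⟨τ z, hmem z z.2⟩
      map_one' := by ext; simp
      map_zero' := by ext; simp
      map_add' := fun a b => by ext; simp
      map_mul' := fun a b => by ext; simp }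
  refine hy.ringHom_of_comp_eq f τ ?_ ?_
  · intro a b hab
    exact Subtype.ext (τ.injective (congrArg Subtype.val hab))
  · ext z; rfl

theorem dd_ball_finite (m r : ℕ) : {k : Fin m → ℕ | ∑ i, k i ≤ r}.Finite := by
  refine (Set.finite_Iic (fun _ : Fin m => r)).subset ?_
  intro k hk i
  exact (Finset.single_le_sum (f := k) (fun _ _ => Nat.zero_le _) (Finset.mem_univ i)).trans hk

theorem dd_ball_card (m : ℕ) : ∀ r, {k : Fin m → ℕ | ∑ i, k i ≤ r}.ncard = (r + m).choose m := by
  induction m with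
  | zero => intro r; simp
  | succ m ih =>
    have split0 : ∀ r, ({k : Fin (m+1) → ℕ | ∑ i, k i ≤ r ∧ k 0 = 0}).ncard = (r + m).choose m := by
      intro r
      rw [← ih r]
      symm
      refine Set.ncard_congr (fun k _ => Fin.cons 0 k) ?_ ?_ ?_
      · intro k hk; simpa [Fin.sum_univ_succ] using hk
      · intro a b _ _ h; exact (Fin.cons_right_injective (α := fun _ => ℕ) 0) h
      · rintro k ⟨h1, h2⟩
        refine ⟨Fin.tail k, ?_, ?_⟩
        · simpa [Fin.sum_univ_succ, h2, Fin.tail] using h1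
        · rw [← h2]; exact Fin.cons_self_tail k
    intro r
    induction r with
    | zero =>
      have : {k : Fin (m+1) → ℕ | ∑ i, k i ≤ 0} = {k : Fin (m+1) → ℕ | ∑ i, k i ≤ 0 ∧ k 0 = 0} := by
        ext k
        simp only [Set.mem_ofPred_eq, Fin.sum_univ_succ]
        omega
      rw [this, split0]; simp
    | succ r ihr =>
      have : {k : Fin (m+1) → ℕ | ∑ i, k i ≤ r + 1} =
          {k : Fin (m+1) → ℕ | ∑ i, k i ≤ r + 1 ∧ k 0 = 0} ∪
          {k : Fin (m+1) → ℕ | ∑ i, k i ≤ r + 1 ∧ k 0 ≠ 0} := by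
        ext k
        simp only [Set.mem_ofPred_eq, Set.mem_union]
        tauto
      rw [this, Set.ncard_union_eq ?_ ((dd_ball_finite _ (r+1)).subset fun k h => h.1)
        ((dd_ball_finite _ (r+1)).subset fun k h => h.1), split0]
      · have h2 : {k : Fin (m+1) → ℕ | ∑ i, k i ≤ r + 1 ∧ k 0 ≠ 0}.ncard =
            {k : Fin (m+1) → ℕ | ∑ i, k i ≤ r}.ncard := by
          symm
          refine Set.ncard_congr (fun k _ => k + Pi.single 0 1) ?_ ?_ ?_
          · intro k hk
            simp only [Set.mem_ofPred_eq, Pi.add_apply, Finset.sum_add_distrib] at hk ⊢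
            simpa using hk
          · intro a b _ _ h; exact add_right_cancel h
          · rintro k ⟨h1, h2⟩
            have hle : (Pi.single 0 1 : Fin (m+1) → ℕ) ≤ k := by
              intro i
              by_cases hi : i = 0
              · subst hi; simp; omega
              · simp [hi]
            refine ⟨k - Pi.single 0 1, ?_, tsub_add_cancel_of_le hle⟩
            have h3 : ∑ i, k i = ∑ i, (k - Pi.single 0 1 : Fin (m+1) → ℕ) i + 1 := by
              conv_lhs => rw [← tsub_add_cancel_of_le hle]
              simp only [Pi.add_apply, Finset.sum_add_distrib]
              simp
            simp only [Set.mem_ofPred_eq]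
            omega
        rw [h2, ihr]
        have := Nat.choose_succ_succ (r + 1 + m) m
        rw [show r + 1 + (m+1) = (r+1+m).succ by omega, this,
          show r + (m+1) = r+1+m by omega]
      · rw [Set.disjoint_left]
        rintro k ⟨_, h⟩ ⟨_, h'⟩
        exact h' h

/-- Eventually an integer combination of `C(r+i,i)`, `i ≤ m`. -/
def DDPoly (m : ℕ) (f : ℕ → ℤ) : Prop :=
  ∃ (a : Fin (m+1) → ℤ) (N : ℕ), ∀ r, N ≤ r →
    f r = ∑ i : Fin (m+1), a i * ((r + (i : ℕ)).choose (i : ℕ) : ℤ)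

theorem DDPoly.add {m : ℕ} {f g : ℕ → ℤ} (hf : DDPoly m f) (hg : DDPoly m g) :
    DDPoly m (fun r => f r + g r) := by
  obtain ⟨a, N, h⟩ := hf
  obtain ⟨b, M, h'⟩ := hg
  refine ⟨a + b, max N M, fun r hr => ?_⟩
  simp only [Pi.add_apply, add_mul, Finset.sum_add_distrib]
  rw [h r (le_trans (le_max_left _ _) hr), h' r (le_trans (le_max_right _ _) hr)]

theorem DDPoly.neg {m : ℕ} {f : ℕ → ℤ} (hf : DDPoly m f) : DDPoly m (fun r => - f r) := by
  obtain ⟨a, N, h⟩ := hf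
  refine ⟨-a, N, fun r hr => ?_⟩
  simp [h r hr]

theorem DDPoly.congr {m : ℕ} {f g : ℕ → ℤ} (hf : DDPoly m f) (N : ℕ)
    (h : ∀ r, N ≤ r → g r = f r) : DDPoly m g := by
  obtain ⟨a, M, h'⟩ := hf
  refine ⟨a, max N M, fun r hr => ?_⟩
  rw [h r (le_trans (le_max_left _ _) hr), h' r (le_trans (le_max_right _ _) hr)]

theorem DDPoly.zero (m : ℕ) : DDPoly m (fun _ => 0) := ⟨0, 0, by simp⟩

theorem DDPoly.mono {m : ℕ} {f : ℕ → ℤ} (hf : DDPoly m f) : DDPoly (m+1) f := by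
  obtain ⟨a, N, h⟩ := hf
  refine ⟨Fin.snoc a 0, N, fun r hr => ?_⟩
  rw [Fin.sum_univ_castSucc, h r hr]
  simp

theorem DDPoly.sum {m : ℕ} {ι : Type*} (s : Finset ι) (f : ι → ℕ → ℤ)
    (h : ∀ i ∈ s, DDPoly m (f i)) : DDPoly m (fun r => ∑ i ∈ s, f i r) := by
  classical
  induction s using Finset.induction_on with
  | empty => simpa using DDPoly.zero m
  | insert i s hi ih =>
    refine ((h i (Finset.mem_insert_self _ _)).add
      (ih fun j hj => h j (Finset.mem_insert_of_mem hj))).congr 0 (fun r _ => ?_)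
    rw [Finset.sum_insert hi]

theorem DDPoly.shifted (d : ℕ) : ∀ m : ℕ, DDPoly m (fun r => ((r - d + m).choose m : ℤ)) := by
  induction d with
  | zero =>
    intro m
    refine ⟨Pi.single (Fin.last m) 1, 0, fun r _ => ?_⟩
    rw [Finset.sum_eq_single (Fin.last m)]
    · simp
    · intro b _ hb; simp [hb]
    · simp
  | succ d ih =>
    intro m
    induction m with
    | zero => 
      exact (ih 0).congr 0 (fun r _ => by simp)
    | succ m _ =>
      refine ((ih (m+1)).add (ih m).mono.neg).congr (d+1) (fun r hr => ?_)
      obtain ⟨t, rfl⟩ := Nat.exists_eq_add_of_le hr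
      have e1 : d + 1 + t - (d+1) = t := by omega
      have e2 : d + 1 + t - d = t + 1 := by omega
      simp only [e1, e2]
      have := Nat.choose_succ_succ (t + 1 + m) m
      rw [show t + 1 + (m+1) = (t+1+m).succ by omega, this,
          show t + (m+1) = t+1+m by omega]
      push_cast; ring

/-- number of points of `E` of order at most `r` -/
noncomputable def ddCount {m : ℕ} (E : Set (Fin m → ℕ)) (r : ℕ) : ℤ :=
  ({k : Fin m → ℕ | ∑ i, k i ≤ r ∧ k ∈ E}.ncard : ℤ)

theorem dd_cone {m : ℕ} (e : Fin m → ℕ) : DDPoly m (ddCount (Set.Ici e)) := by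
  refine (DDPoly.shifted (∑ i, e i) m).congr (∑ i, e i) (fun r hr => ?_)
  unfold ddCount
  rw [← dd_ball_card]
  congr 1
  symm
  refine Set.ncard_congr (fun k _ => k + e) ?_ ?_ ?_
  · intro k hk
    simp only [Set.mem_ofPred_eq, Pi.add_apply, Finset.sum_add_distrib, Set.mem_Ici] at hk ⊢
    exact ⟨by omega, le_add_self⟩
  · intro a b _ _ h; exact add_right_cancel h
  · rintro k ⟨h1, h2⟩
    have hle : e ≤ k := h2
    refine ⟨k - e, ?_, tsub_add_cancel_of_le hle⟩
    have h3 : ∑ i, k i = ∑ i, (k - e) i + ∑ i, e i := by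
      conv_lhs => rw [← tsub_add_cancel_of_le hle]
      simp only [Pi.add_apply, Finset.sum_add_distrib]
    simp only [Set.mem_ofPred_eq]
    omega

theorem dd_fg {m : ℕ} (n : ℕ) : ∀ l : List (Fin m → ℕ), l.length = n →
    DDPoly m (ddCount {k | ∃ e ∈ l, e ≤ k}) := by
  induction n with
  | zero =>
    intro l hl
    obtain rfl := List.length_eq_zero_iff.mp hl
    exact (DDPoly.zero m).congr 0 (fun r _ => by simp [ddCount])
  | succ n ih =>
    intro l hl
    match l, hl with
    | e :: l, hl =>
      have hl' : l.length = n := by simpa using hl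
      have h1 := ih l hl'
      have h2 := ih (l.map (e ⊔ ·)) (by simpa using hl')
      refine (((dd_cone e).add h1).add h2.neg).congr 0 (fun r _ => ?_)
      unfold ddCount
      have := Set.ncard_union_add_ncard_inter
        {k : Fin m → ℕ | ∑ i, k i ≤ r ∧ k ∈ Set.Ici e}
        {k : Fin m → ℕ | ∑ i, k i ≤ r ∧ k ∈ {k | ∃ e ∈ l, e ≤ k}}
        ((dd_ball_finite _ r).subset fun k h => h.1) ((dd_ball_finite _ r).subset fun k h => h.1)
      have e1 : {k : Fin m → ℕ | ∑ i, k i ≤ r ∧ k ∈ Set.Ici e} ∪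
        {k : Fin m → ℕ | ∑ i, k i ≤ r ∧ k ∈ {k | ∃ e ∈ l, e ≤ k}} =
        {k : Fin m → ℕ | ∑ i, k i ≤ r ∧ k ∈ {k | ∃ e' ∈ e :: l, e' ≤ k}} := by
        ext k
        simp only [Set.mem_union, Set.mem_ofPred_eq, Set.mem_Ici, List.mem_cons,
          exists_eq_or_imp]
        tauto
      have e2 : {k : Fin m → ℕ | ∑ i, k i ≤ r ∧ k ∈ Set.Ici e} ∩
        {k : Fin m → ℕ | ∑ i, k i ≤ r ∧ k ∈ {k | ∃ e ∈ l, e ≤ k}} =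
        {k : Fin m → ℕ | ∑ i, k i ≤ r ∧ k ∈ {k | ∃ e' ∈ l.map (e ⊔ ·), e' ≤ k}} := by
        ext k
        simp only [Set.mem_inter_iff, Set.mem_ofPred_eq, Set.mem_Ici, List.mem_map,
          exists_exists_and_eq_and, sup_le_iff]
        constructor
        · rintro ⟨⟨a, b⟩, _, c, d, f⟩; exact ⟨a, c, d, b, f⟩
        · rintro ⟨a, c, d, b, f⟩; exact ⟨⟨a, b⟩, a, c, d, f⟩
      rw [e1, e2] at this
      omega

theorem dd_upper {m : ℕ} (E : Set (Fin m → ℕ)) (hE : IsUpperSet E) : DDPoly m (ddCount E) := by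
  have hfin : {e | Minimal (· ∈ E) e}.Finite :=
    WellQuasiOrderedLE.finite_of_isAntichain (setOfPred_minimal_antichain _)
  have := dd_fg _ hfin.toFinset.toList rfl
  have hEe : E = {k | ∃ e ∈ hfin.toFinset.toList, e ≤ k} := by
    ext k
    simp only [Finset.mem_toList, Set.Finite.mem_toFinset, Set.mem_ofPred_eq]
    constructor
    · intro hk
      obtain ⟨e, he, hm⟩ := exists_minimal_le_of_wellFoundedLT (· ∈ E) k hk
      exact ⟨e, hm, he⟩
    · rintro ⟨e, he, hek⟩
      exact hE hek he.1
  rw [hEe]; exact this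

theorem dd_compl {m : ℕ} (E : Set (Fin m → ℕ)) (hE : IsUpperSet E) : DDPoly m (ddCount Eᶜ) := by
  refine ((dd_upper _ isUpperSet_univ).add (dd_upper E hE).neg).congr 0 (fun r _ => ?_)
  unfold ddCount
  have e1 : {k : Fin m → ℕ | ∑ i, k i ≤ r ∧ k ∈ (Set.univ : Set (Fin m → ℕ))} =
    {k | ∑ i, k i ≤ r ∧ k ∈ Eᶜ} ∪ {k | ∑ i, k i ≤ r ∧ k ∈ E} := by
    ext k; simp only [Set.mem_ofPred_eq, Set.mem_univ, Set.mem_union, Set.mem_compl_iff]; tauto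
  rw [e1, Set.ncard_union_eq ?_ ((dd_ball_finite _ r).subset fun k h => h.1)
    ((dd_ball_finite _ r).subset fun k h => h.1)]
  · push_cast; ring
  · rw [Set.disjoint_left]
    rintro k ⟨_, h⟩ ⟨_, h'⟩
    exact h h'

theorem dd_binom (i r : ℕ) : (binomialPoly i).eval (r : ℚ) = ((r + i).choose i : ℚ) := by
  unfold binomialPoly
  rw [Polynomial.eval_mul, Polynomial.eval_C, Polynomial.eval_prod]
  have h : ∏ j ∈ Finset.range i, (X + C ((j : ℚ) + 1)).eval (r : ℚ) =
      ((r+1).ascFactorial i : ℚ) := by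
    rw [Nat.ascFactorial_eq_prod_range]
    push_cast
    refine Finset.prod_congr rfl fun j _ => ?_
    simp; ring
  rw [h, Nat.ascFactorial_eq_factorial_mul_choose]
  have : (i.factorial : ℚ) ≠ 0 := by exact_mod_cast i.factorial_ne_zero
  push_cast
  field_simp

/-- Existence of the difference dimension polynomial of a finitely generated
difference field extension (Theorem III.3 in the difference case): there is a
polynomial `φ(t) = ∑_{i=0}^m a_i C(t+i, i)` with integer `a_i` whose value at
all sufficiently large `r` is the transcendence degree over `K` of the field
obtained from `K` by adjoining all `θ_k(η_j)` with `ord θ_k ≤ r`. -/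
theorem difference_dimension_polynomial_exists
    (L : Type*) [Field L] (m s : ℕ) (hm : 1 ≤ m) (hs : 1 ≤ s)
    (σ : Fin m → (L →+* L))
    (hinj : ∀ i, Function.Injective (σ i))
    (hcomm : ∀ i j, (σ i).comp (σ j) = (σ j).comp (σ i))
    (K : Subfield L) (hK : ∀ i, ∀ x ∈ K, σ i x ∈ K)
    (η : Fin s → L) :
    ∃ (φ : Polynomial ℚ) (a : Fin (m + 1) → ℤ),
      φ = ∑ i : Fin (m + 1), (a i : ℚ) • binomialPoly (i : ℕ) ∧
      ∃ N : ℕ, ∀ r : ℕ, N ≤ r → ∃ d : ℕ,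
        trdeg ↥K ↥(IntermediateField.adjoin ↥K
            {x : L | ∃ k : Fin m → ℕ, (∑ i, k i) ≤ r ∧
              ∃ j : Fin s, x = thetaApply σ k (η j)}) = (d : Cardinal) ∧
        φ.eval (r : ℚ) = (d : ℚ) := by
  classical
  let key : (Fin m → ℕ) × Fin s → ℕ ×ₗ (Lex (Fin m → ℕ) ×ₗ Fin s) :=
    fun p => toLex (∑ i, p.1 i, toLex (toLex p.1, p.2))
  have hkey : Function.Injective key := by
    rintro ⟨a, b⟩ ⟨c, d⟩ h
    have h' := congrArg (fun z => ofLex (ofLex z).2) h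
    simp only [key, ofLex_toLex, Prod.mk.injEq] at h'
    exact Prod.ext (toLex.injective h'.1) h'.2
  have hkshift : ∀ (e : Fin m → ℕ) p q, key p < key q →
      key (p.1 + e, p.2) < key (q.1 + e, q.2) := by
    intro e p q h
    simp only [key, Prod.Lex.toLex_lt_toLex] at h ⊢
    simp only [Pi.add_apply, Finset.sum_add_distrib, toLex_add]
    rcases h with h | ⟨h1, h | ⟨h2, h3⟩⟩
    · left; omega
    · right; exact ⟨by omega, Or.inl (add_lt_add_left h _)⟩
    · right; exact ⟨by omega, Or.inr ⟨by rw [h2], h3⟩⟩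
  have hkle : ∀ p q, key p < key q → ∑ i, p.1 i ≤ ∑ i, q.1 i := by
    intro p q h
    simp only [key, Prod.Lex.toLex_lt_toLex] at h
    rcases h with h | ⟨h, _⟩ <;> omega
  let x : (Fin m → ℕ) × Fin s → L := fun p => thetaApply σ p.1 (η p.2)
  let D : Set ((Fin m → ℕ) × Fin s) :=
    {i | IsAlgebraic (Algebra.adjoin K (x '' {j | key j < key i})) (x i)}
  have hDs : ∀ (k : Fin m → ℕ) j i, (k, j) ∈ D → (k + Pi.single i 1, j) ∈ D := by
    intro k j i h
    have := dd_shift K (σ i) (hK i) _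
      (x '' {p | key p < key (k + Pi.single i 1, j)}) ?_ _ h
    · simp only [D, Set.mem_ofPred_eq]
      have e : x (k + Pi.single i 1, j) = σ i (x (k, j)) := dd_theta_succ σ hcomm k i _
      rw [e]; exact this
    · rintro _ ⟨p, hp, rfl⟩
      exact ⟨(p.1 + Pi.single i 1, p.2), hkshift _ p (k, j) hp, dd_theta_succ σ hcomm p.1 i _⟩
  have hup : ∀ j, IsUpperSet {k : Fin m → ℕ | (k, j) ∈ D} := by
    intro j
    have aux : ∀ n : ℕ, ∀ a b : Fin m → ℕ, a ≤ b → ∑ i, (b - a) i = n → (a, j) ∈ D →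
        (b, j) ∈ D := by
      intro n
      induction n with
      | zero =>
        intro a b hab h0 ha
        have : b = a := by
          refine le_antisymm ?_ hab
          intro i
          have := (Finset.sum_eq_zero_iff.mp h0) i (Finset.mem_univ i)
          have h7 : b i - a i = 0 := this
          show b i ≤ a i
          omega
        rw [this]; exact ha
      | succ n ih =>
        intro a b hab h0 ha
        obtain ⟨i, _, hi⟩ : ∃ i ∈ Finset.univ, (b - a) i ≠ 0 :=
          Finset.exists_ne_zero_of_sum_ne_zero (by omega)
        have hle : a + Pi.single i 1 ≤ b := by
          intro t
          have := hab t
          by_cases ht : t = i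
          · subst ht
            simp only [Pi.sub_apply] at hi
            simp only [Pi.add_apply, Pi.single_eq_same]
            omega
          · simpa [ht] using this
        refine ih (a + Pi.single i 1) b hle ?_ (hDs a j i ha)
        have h3 : b - a = (b - (a + Pi.single i 1)) + Pi.single i 1 := by
          ext t
          have := hle t
          simp only [Pi.sub_apply, Pi.add_apply] at this ⊢
          omega
        rw [h3] at h0
        simp only [Pi.add_apply, Finset.sum_add_distrib] at h0
        simpa using h0
    intro a b hab ha
    exact aux _ a b hab rfl ha
  obtain ⟨a, N, haN⟩ := DDPoly.sum Finset.univ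
    (fun j : Fin s => ddCount {k : Fin m → ℕ | (k, j) ∈ D}ᶜ) (fun j _ => dd_compl _ (hup j))
  refine ⟨_, a, rfl, N, fun r hr => ?_⟩
  have hTfin : {p : (Fin m → ℕ) × Fin s | ∑ i, p.1 i ≤ r}.Finite :=
    ((dd_ball_finite m r).prod (Set.finite_univ (α := Fin s))).subset
      (fun p hp => ⟨hp, trivial⟩)
  obtain ⟨g1, g2⟩ := dd_greedy (K := K) key hkey x D (fun i => Iff.rfl) _ hTfin.toFinset rfl (by
    intro i hi j hj
    rw [Set.Finite.mem_toFinset] at hi ⊢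
    exact (hkle _ _ hj).trans hi)
  have hset : {x : L | ∃ k : Fin m → ℕ, (∑ i, k i) ≤ r ∧
      ∃ j : Fin s, x = thetaApply σ k (η j)} = x '' (hTfin.toFinset : Set _) := by
    ext z
    simp only [Set.Finite.coe_toFinset, Set.mem_image, Set.mem_ofPred_eq, Prod.exists, x]
    constructor
    · rintro ⟨k, hk, j, rfl⟩; exact ⟨k, j, hk, rfl⟩
    · rintro ⟨k, j, hk, rfl⟩; exact ⟨k, hk, j, rfl⟩
  refine ⟨((hTfin.toFinset : Set _) \ D).ncard, ?_, ?_⟩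
  · rw [hset]
    exact dd_trdeg x _ _ Set.sdiff_subset ((Finset.finite_toSet _).subset Set.sdiff_subset) g1 g2
  · have hcount : ((((hTfin.toFinset : Set _) \ D).ncard : ℕ) : ℤ) =
        ∑ j : Fin s, ddCount {k : Fin m → ℕ | (k, j) ∈ D}ᶜ r := by
      have hfin : ∀ j : Fin s, {k : Fin m → ℕ | ∑ i, k i ≤ r ∧ k ∈ {k | (k, j) ∈ D}ᶜ}.Finite :=
        fun j => (dd_ball_finite _ r).subset fun k h => h.1
      have hsum : ((hTfin.toFinset : Set _) \ D).ncard = ∑ j : Fin s,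
          {k : Fin m → ℕ | ∑ i, k i ≤ r ∧ k ∈ {k | (k, j) ∈ D}ᶜ}.ncard := by
        have hF : ((hTfin.toFinset : Set _) \ D) =
            ((Finset.univ.sigma fun j => (hfin j).toFinset).image
              (fun q : (Σ _ : Fin s, Fin m → ℕ) => (q.2, q.1)) : Finset _) := by
          ext ⟨k, j⟩
          simp
        rw [hF, Set.ncard_coe_finset, Finset.card_image_of_injective, Finset.card_sigma]
        · exact Finset.sum_congr rfl fun j _ => (Set.ncard_eq_toFinset_card _ (hfin j)).symm
        · rintro ⟨a, b⟩ ⟨c, d⟩ h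
          simp only [Prod.mk.injEq] at h
          obtain ⟨rfl, rfl⟩ := h
          rfl
      rw [hsum]
      unfold ddCount
      push_cast
      rfl
    have h5 := haN r hr
    beta_reduce at h5
    rw [← hcount] at h5
    have h6 : ((((hTfin.toFinset : Set _) \ D).ncard : ℕ) : ℚ) =
        ((((((hTfin.toFinset : Set _) \ D).ncard : ℕ) : ℤ)) : ℚ) := by push_cast; rfl
    rw [h6, h5, Polynomial.eval_finsetSum]
    push_cast
    refine Finset.sum_congr rfl fun i _ => ?_
    rw [Polynomial.eval_smul, dd_binom, smul_eq_mul]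
end

section
/- Let L be a field of characteristic 0, m, s ≥ 1, δ₁,…,δ_m pairwise commuting derivations of L, and K a subfield of L with δᵢ(K) ⊆ K for all i. Let η₁,…,η_s ∈ L. Then there exists a polynomial φ ∈ ℚ[t] and integers a₀,…,a_m such that φ(t) = ∑_{i=0}^{m} a_i · C(t+i, i) (in particular deg φ ≤ m) and, for all sufficiently large r ∈ ℕ, φ(r) equals the transcendence degree over K of the subfield of L generated over K by the set {δ₁^{k₁}∘⋯∘δ_m^{k_m}(η_j) : k₁,…,k_m ∈ ℕ, k₁+⋯+k_m ≤ r, 1 ≤ j ≤ s}. -/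
open Polynomial

set_option synthInstance.maxHeartbeats 1000000
set_option maxHeartbeats 1000000

/-- `θ_k = δ₁^{k₁} ∘ ⋯ ∘ δ_m^{k_m}` for a family of derivations `δ`. -/
noncomputable def thetaApplyDer {L : Type*} [Field L] [CharZero L] {m : ℕ}
    (δ : Fin m → Derivation ℚ L L) (k : Fin m → ℕ) : L → L :=
  (List.ofFn fun i => (⇑(δ i))^[k i]).foldr (· ∘ ·) id


namespace KolchinAux

/-- Eventually polynomial integer functions of degree at most the first argument. -/
def EvPoly : ℕ → (ℕ → ℤ) → Prop
  | 0, f => ∃ (c : ℤ) (N : ℕ), ∀ r, N ≤ r → f r = c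
  | m + 1, f => EvPoly m (fun r => f (r + 1) - f r)

theorem EvPoly.add {m : ℕ} {f g : ℕ → ℤ} (hf : EvPoly m f) (hg : EvPoly m g) :
    EvPoly m (fun r => f r + g r) := by
  induction m generalizing f g with
  | zero =>
    obtain ⟨c, N, h⟩ := hf
    obtain ⟨c', N', h'⟩ := hg
    exact ⟨c + c', max N N', fun r hr => by
      change f r + g r = _
      rw [h r (le_trans (le_max_left _ _) hr), h' r (le_trans (le_max_right _ _) hr)]⟩
  | succ m ih =>
    have := ih hf hg
    unfold EvPoly
    convert this using 2
    ring

theorem EvPoly.succ_iff {m : ℕ} {f : ℕ → ℤ} :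
    EvPoly m (fun r => f (r + 1)) ↔ EvPoly m f := by
  induction m generalizing f with
  | zero =>
    constructor
    · rintro ⟨c, N, h⟩
      refine ⟨c, N + 1, fun r hr => ?_⟩
      obtain ⟨r, rfl⟩ : ∃ q, r = q + 1 := ⟨r - 1, by omega⟩
      exact h r (by omega)
    · rintro ⟨c, N, h⟩
      exact ⟨c, N, fun r hr => h _ (by omega)⟩
  | succ m ih => exact ih (f := fun r => f (r + 1) - f r)

theorem EvPoly.mono {m : ℕ} {f : ℕ → ℤ} (hf : EvPoly m f) : EvPoly (m + 1) f := by
  induction m generalizing f with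
  | zero =>
    obtain ⟨c, N, h⟩ := hf
    exact ⟨0, N, fun r hr => by simp [h r hr, h (r + 1) (by omega)]⟩
  | succ m ih => exact ih (f := fun r => f (r + 1) - f r) hf

theorem EvPoly.zero (m : ℕ) : EvPoly m (fun _ => 0) := by
  induction m with
  | zero => exact ⟨0, 0, fun _ _ => rfl⟩
  | succ m ih => exact ih.mono

theorem EvPoly.sum {m : ℕ} {ι : Type*} (s : Finset ι) {f : ι → ℕ → ℤ}
    (hf : ∀ i ∈ s, EvPoly m (f i)) : EvPoly m (fun r => ∑ i ∈ s, f i r) := by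
  classical
  induction s using Finset.induction_on with
  | empty => simpa using EvPoly.zero m
  | insert a s ha ih =>
    simp only [Finset.sum_insert ha]
    exact (hf a (by simp)).add (ih fun i hi => hf i (by simp [hi]))

theorem EvPoly.exists_coeff {m : ℕ} {f : ℕ → ℤ} (hf : EvPoly m f) :
    ∃ (a : ℕ → ℤ) (N : ℕ), ∀ r, N ≤ r →
      f r = ∑ i ∈ Finset.range (m + 1), a i * ((r + i).choose i : ℤ) := by
  induction m generalizing f with
  | zero =>
    obtain ⟨c, N, h⟩ := hf
    exact ⟨fun _ => c, N, fun r hr => by simp [h r hr]⟩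
  | succ m ih =>
    obtain ⟨a, N, h⟩ := ih hf
    let g : ℕ → ℤ := fun r => ∑ i ∈ Finset.range (m + 1), a i * ((r + i).choose (i + 1) : ℤ)
    have hg : ∀ r, N ≤ r → f (r + 1) - g (r + 1) = f r - g r := by
      intro r hr
      have h1 := h r hr
      have h2 : g (r + 1) - g r =
          ∑ i ∈ Finset.range (m + 1), a i * ((r + i).choose i : ℤ) := by
        rw [← Finset.sum_sub_distrib]
        refine Finset.sum_congr rfl fun i _ => ?_
        rw [show r + 1 + i = r + i + 1 by ring, Nat.choose_succ_succ]
        push_cast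
        ring
      linarith
    have hc : ∀ r, N ≤ r → f r - g r = f N - g N := by
      intro r hr
      induction r, hr using Nat.le_induction with
      | base => rfl
      | succ r hr ih => rw [hg r hr, ih]
    refine ⟨fun i => (if i = 0 then f N - g N else a (i - 1)) - (if i ≤ m then a i else 0), N,
      fun r hr => ?_⟩
    have h3 : f r = g r + (f N - g N) := by linarith [hc r hr]
    rw [h3]
    simp only [sub_mul, Finset.sum_sub_distrib]
    rw [Finset.sum_range_succ' (n := m + 1)]
    rw [Finset.sum_range_succ (n := m + 1) (f := fun x => (if x ≤ m then a x else 0) * _)]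
    simp only [Nat.add_eq_zero_iff, one_ne_zero, and_false, if_false, Nat.add_sub_cancel, if_true]
    have h4 : ∑ x ∈ Finset.range (m + 1), (if x ≤ m then a x else 0) * ((r + x).choose x : ℤ)
        = ∑ x ∈ Finset.range (m + 1), a x * ((r + x).choose x : ℤ) := by
      refine Finset.sum_congr rfl fun i hi => ?_
      rw [if_pos (by have := Finset.mem_range.1 hi; omega)]
    have h5 : g r = ∑ x ∈ Finset.range (m + 1), a x * ((r + (x + 1)).choose (x + 1) : ℤ) -
        ∑ x ∈ Finset.range (m + 1), a x * ((r + x).choose x : ℤ) := by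
      rw [← Finset.sum_sub_distrib]
      refine Finset.sum_congr rfl fun i _ => ?_
      rw [show r + (i + 1) = r + i + 1 by ring, Nat.choose_succ_succ]
      push_cast
      ring
    rw [h4, h5]
    simp
    ring

theorem upperSet_wf (α : Type*) [PartialOrder α] [WellQuasiOrderedLE α] :
    WellFoundedLT (UpperSet α) := by
  rw [WellFoundedLT, isWellFounded_iff, wellFounded_iff_isEmpty_descending_chain]
  refine ⟨fun ⟨f, hf⟩ => ?_⟩
  have hex : ∀ n, ∃ k, k ∈ f (n + 1) ∧ k ∉ f n := by
    intro n
    by_contra! h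
    exact (hf n).not_ge fun k hk => h k hk
  choose k hk1 hk2 using hex
  have hanti : Antitone f := antitone_nat_of_succ_le fun n => (hf n).le
  obtain ⟨i, j, hij, h⟩ := wellQuasiOrdered_le k
  exact hk2 j ((f j).upper h (hanti (Nat.succ_le_of_lt hij) (hk1 i)))

/-- The points of bounded degree outside a set. -/
def cnt {m : ℕ} (U : Set (Fin m → ℕ)) (r : ℕ) : Set (Fin m → ℕ) :=
  {k | k ∉ U ∧ ∑ i, k i ≤ r}

theorem cnt_finite {m : ℕ} (U : Set (Fin m → ℕ)) (r : ℕ) : (cnt U r).Finite := by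
  refine (Set.finite_Iic (fun _ : Fin m => r)).subset ?_
  rintro k ⟨-, hk⟩ i
  exact (Finset.single_le_sum (f := k) (fun _ _ => Nat.zero_le _) (Finset.mem_univ i)).trans hk

/-- Unit exponent vectors. -/
def eu {m : ℕ} (i : Fin m) : Fin m → ℕ := Pi.single i 1

theorem sum_eu {m : ℕ} (i : Fin m) : ∑ j, eu i j = 1 := by simp [eu]

theorem cnt_succ {m : ℕ} (U : Set (Fin (m + 1) → ℕ)) (r : ℕ) :
    (cnt U (r + 1)).ncard =
      (cnt {k : Fin m → ℕ | Fin.cons 0 k ∈ U} (r + 1)).ncard +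
      (cnt {k : Fin (m + 1) → ℕ | k + eu 0 ∈ U} r).ncard := by
  have hinj1 : Function.Injective (fun k : Fin m → ℕ => (Fin.cons 0 k : Fin (m + 1) → ℕ)) :=
    fun a b h => (Fin.cons_inj.1 h).2
  have hinj2 : Function.Injective (fun k : Fin (m + 1) → ℕ => k + eu 0) :=
    fun a b h => add_right_cancel h
  rw [← Set.ncard_image_of_injective (cnt {k : Fin m → ℕ | Fin.cons 0 k ∈ U} (r + 1)) hinj1,
    ← Set.ncard_image_of_injective (cnt {k : Fin (m + 1) → ℕ | k + eu 0 ∈ U} r) hinj2,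
    ← Set.ncard_union_eq ?_ ((cnt_finite _ _).image _) ((cnt_finite _ _).image _)]
  · congr 1
    ext k
    simp only [cnt, Set.mem_ofPred_eq, Set.mem_union, Set.mem_image]
    constructor
    · rintro ⟨h1, h2⟩
      by_cases h0 : k 0 = 0
      · left
        refine ⟨Fin.tail k, ⟨?_, ?_⟩, ?_⟩
        · rw [← h0, Fin.cons_self_tail]; exact h1
        · rw [Fin.sum_univ_succ] at h2
          simp only [Fin.tail]; omega
        · rw [← h0, Fin.cons_self_tail]
      · right
        have hk : k - eu 0 + eu 0 = k := by
          ext i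
          by_cases hi : i = 0
          · subst hi; simp [eu]; omega
          · simp [eu, hi]
        refine ⟨k - eu 0, ⟨?_, ?_⟩, hk⟩
        · rwa [hk]
        · rw [← hk] at h2
          simp only [Pi.add_apply, Finset.sum_add_distrib, sum_eu] at h2
          omega
    · rintro (⟨k, ⟨h1, h2⟩, rfl⟩ | ⟨k, ⟨h1, h2⟩, rfl⟩)
      · refine ⟨h1, ?_⟩
        simpa [Fin.sum_univ_succ] using h2
      · refine ⟨h1, ?_⟩
        simp only [Pi.add_apply, Finset.sum_add_distrib, sum_eu]
        omega
  · rw [Set.disjoint_left]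
    rintro _ ⟨k, -, rfl⟩ ⟨k', -, h⟩
    have := congrFun h 0
    simp [eu] at this

theorem cnt_evPoly (m : ℕ) (U : UpperSet (Fin m → ℕ)) :
    EvPoly m (fun r => ((cnt (U : Set (Fin m → ℕ)) r).ncard : ℤ)) := by
  induction m with
  | zero =>
    refine ⟨((cnt (U : Set (Fin 0 → ℕ)) 0).ncard : ℤ), 0, fun r _ => ?_⟩
    simp [cnt]
  | succ m ih =>
    have := upperSet_wf (Fin (m + 1) → ℕ)
    induction U using WellFoundedLT.induction with
    | ind U ih2 =>
    let U0 : UpperSet (Fin m → ℕ) := ⟨{k | Fin.cons 0 k ∈ U}, fun a b hab ha =>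
      U.upper (Fin.cons_le_cons.2 ⟨le_rfl, hab⟩) ha⟩
    let U1 : UpperSet (Fin (m + 1) → ℕ) := ⟨{k | k + eu 0 ∈ U}, fun a b hab ha =>
      U.upper (add_le_add_left hab _) ha⟩
    have key : ∀ r, (cnt (U : Set (Fin (m + 1) → ℕ)) (r + 1)).ncard =
      (cnt (U0 : Set (Fin m → ℕ)) (r + 1)).ncard +
      (cnt (U1 : Set (Fin (m + 1) → ℕ)) r).ncard := fun r => cnt_succ _ r
    have hle : U1 ≤ U := fun k hk => U.upper (by simp) hk
    rcases hle.eq_or_lt with h | h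
    · have h0 := EvPoly.succ_iff.2 (ih U0)
      unfold EvPoly
      convert h0 using 2 with r
      beta_reduce
      rw [key, h]
      push_cast
      ring
    · have h0 := (EvPoly.succ_iff.2 (ih U0)).mono
      have h1 := h0.add (ih2 U1 h)
      rw [← EvPoly.succ_iff]
      convert h1 using 2 with r
      rw [key]
      push_cast
      ring

theorem binomialPoly_eval (i r : ℕ) :
    (binomialPoly i).eval (r : ℚ) = ((r + i).choose i : ℚ) := by
  unfold binomialPoly
  rw [Polynomial.eval_mul, Polynomial.eval_C, Polynomial.eval_prod]
  simp only [Polynomial.eval_add, Polynomial.eval_X, Polynomial.eval_C]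
  have h := Nat.ascFactorial_eq_factorial_mul_choose r i
  rw [Nat.ascFactorial_eq_prod_range] at h
  have h' : (∏ j ∈ Finset.range i, ((r : ℚ) + ((j : ℚ) + 1))) = i.factorial * (r + i).choose i := by
    rw [← Nat.cast_mul, ← h]
    push_cast
    exact Finset.prod_congr rfl fun j _ => by ring
  rw [h', inv_mul_cancel_left₀ (by positivity)]

theorem trdeg_eq_algebra_trdeg (K A : Type*) [CommRing K] [CommRing A] [Algebra K A] :
    _root_.trdeg K A = Algebra.trdeg K A := rfl

section Indep

variable {K L J : Type*} [Field K] [Field L] [Algebra K L] [LinearOrder J]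

/-- The indices whose element is algebraic over the previous ones. -/
def dep (K : Type*) {L J : Type*} [Field K] [Field L] [Algebra K L] [LinearOrder J]
    (x : J → L) : Set J :=
  {p | IsAlgebraic (Algebra.adjoin K (x '' Set.Iio p)) (x p)}

theorem indep_finset (x : J → L) (A : Finset J) (hA : ∀ p ∈ A, p ∉ dep K x) :
    AlgebraicIndepOn K x (A : Set J) := by
  induction A using Finset.induction_on_max with
  | empty =>
    simp only [Finset.coe_empty]
    exact algebraicIndependent_empty_type_iff.2 (algebraMap K L).injective
  | insert p s hp ih =>
    rw [Finset.coe_insert]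
    refine AlgebraicIndepOn.insert (ih fun q hq => hA q (by simp [hq])) ?_
    intro halg
    refine hA p (by simp) ?_
    exact halg.adjoin_of_forall_isAlgebraic (fun y hy =>
      absurd (Set.image_mono (fun q hq => hp q hq) hy.1) hy.2)

theorem alg_dep [WellFoundedLT J] (x : J → L) {T : Set J} (hT : IsLowerSet T) (p : J) (hp : p ∈ T) :
    IsAlgebraic (Algebra.adjoin K (x '' (T \ dep K x))) (x p) := by
  induction p using WellFoundedLT.induction with
  | ind p ih =>
  by_cases hd : p ∈ dep K x
  · refine IsAlgebraic.adjoin_of_forall_isAlgebraic ?_ hd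
    rintro _ ⟨⟨q, hq, rfl⟩, -⟩
    exact ih q hq (hT (le_of_lt hq) hp)
  · exact isAlgebraic_algebraMap
      (⟨x p, Algebra.subset_adjoin ⟨p, ⟨hp, hd⟩, rfl⟩⟩ : Algebra.adjoin K (x '' (T \ dep K x)))

theorem isAlgebraic_transfer (F : IntermediateField K L) (S : Set F) (z : F)
    (h : IsAlgebraic (Algebra.adjoin K (F.val '' S)) (z : L)) :
    IsAlgebraic (Algebra.adjoin K S) z := by
  rw [← AlgHom.map_adjoin] at h
  exact (isAlgebraic_ringHom_iff_of_comp_eq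
    ((Algebra.adjoin K S).equivMapOfInjective F.val F.val.injective) F.val F.val.injective rfl).1 h

theorem trdeg_adjoin [WellFoundedLT J] (x : J → L) {T : Set J} (hT : IsLowerSet T) (hfin : T.Finite) :
    Algebra.trdeg K (IntermediateField.adjoin K (x '' T)) =
      (((T \ dep K x).ncard : ℕ) : Cardinal) := by
  set F := IntermediateField.adjoin K (x '' T) with hF
  set B := T \ dep K x with hB
  have hBfin : B.Finite := hfin.subset Set.sdiff_subset
  let y : B → F := fun p => ⟨x p, IntermediateField.subset_adjoin _ _ ⟨p, p.2.1, rfl⟩⟩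
  have hy : IsTranscendenceBasis K y := by
    rw [isTranscendenceBasis_iff_algebraicIndependent_isAlgebraic]
    constructor
    · have h := indep_finset (K := K) x hBfin.toFinset (fun p hp => by
        rw [Set.Finite.mem_toFinset] at hp; exact hp.2)
      rw [Set.Finite.coe_toFinset] at h
      exact AlgebraicIndependent.of_comp F.val h
    · refine ⟨fun z => isAlgebraic_transfer F _ z ?_⟩
      have hr : F.val '' Set.range y = x '' B := by
        rw [← Set.range_comp, Set.image_eq_range]; rfl
      rw [hr]
      have hz : IsAlgebraic (Algebra.adjoin K (x '' T)) (z : L) :=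
        IntermediateField.isAlgebraic_adjoin_iff.1 (isAlgebraic_algebraMap (A := L) z)
      refine hz.adjoin_of_forall_isAlgebraic ?_
      rintro _ ⟨⟨q, hq, rfl⟩, -⟩
      exact alg_dep x hT q hq
  have h := hy.lift_cardinalMk_eq_trdeg
  have : Finite B := hBfin
  rw [← Nat.cast_card] at h
  simp only [Cardinal.lift_natCast] at h
  rw [← Nat.card_coe_set_eq]
  exact Cardinal.lift_injective (by rw [← h, Cardinal.lift_natCast])

end Indep

section Der

variable {L : Type*} [Field L] [CharZero L] (D : Derivation ℚ L L) (K : Subfield L)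

theorem der_adjoin (hK : ∀ x ∈ K, D x ∈ K) {S : Set L} {M : IntermediateField K L}
    (hS : ∀ x ∈ S, x ∈ M) (hDS : ∀ x ∈ S, D x ∈ M) {z : L}
    (hz : z ∈ IntermediateField.adjoin K S) : D z ∈ M := by
  have hle : IntermediateField.adjoin K S ≤ M := IntermediateField.adjoin_le_iff.2 hS
  induction hz using IntermediateField.adjoin_induction with
  | mem x hx => exact hDS x hx
  | algebraMap x => exact M.algebraMap_mem ⟨D x, hK _ x.2⟩
  | add x y hx hy h1 h2 => rw [map_add]; exact M.add_mem h1 h2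
  | inv x hx h =>
    rw [Derivation.leibniz_inv, smul_eq_mul]
    exact M.mul_mem (M.neg_mem (pow_mem (M.inv_mem (hle hx)) 2)) h
  | mul x y hx hy h1 h2 =>
    rw [Derivation.leibniz, smul_eq_mul, smul_eq_mul]
    exact M.add_mem (M.mul_mem (hle hx) h2) (M.mul_mem (hle hy) h1)

theorem der_algebraic (hK : ∀ x ∈ K, D x ∈ K) {S : Set L} {M : IntermediateField K L}
    (hS : ∀ x ∈ S, x ∈ M) (hDS : ∀ x ∈ S, D x ∈ M) {y : L} (hyM : y ∈ M)
    (hy : IsAlgebraic (IntermediateField.adjoin K S) y) : D y ∈ M := by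
  have hle : IntermediateField.adjoin K S ≤ M := IntermediateField.adjoin_le_iff.2 hS
  have hev : ∀ q : Polynomial (IntermediateField.adjoin K S), Polynomial.aeval y q ∈ M := by
    intro q
    rw [Polynomial.aeval_eq_sum_range]
    refine M.sum_mem fun i _ => ?_
    rw [Algebra.smul_def]
    exact M.mul_mem (hle (q.coeff i).2) (pow_mem hyM i)
  have key : ∀ q : Polynomial (IntermediateField.adjoin K S),
      ∃ c ∈ M, D (Polynomial.aeval y q) = c + Polynomial.aeval y (derivative q) * D y := by
    intro q
    induction q using Polynomial.induction_on' with
    | add p q hp hq =>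
      obtain ⟨c, hc, h⟩ := hp
      obtain ⟨c', hc', h'⟩ := hq
      refine ⟨c + c', M.add_mem hc hc', ?_⟩
      rw [map_add, map_add, h, h', derivative_add, map_add]
      ring
    | monomial n a =>
      refine ⟨y ^ n * D (a : L), M.mul_mem (pow_mem hyM n) (der_adjoin D K hK hS hDS a.2), ?_⟩
      rw [derivative_monomial, Polynomial.aeval_monomial, Polynomial.aeval_monomial,
        Derivation.leibniz, Derivation.leibniz_pow, map_mul, map_natCast]
      simp only [smul_eq_mul, nsmul_eq_mul]
      change (a : L) * _ + y ^ n * D (a : L) = _ + (a : L) * _ * _ * _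
      ring
  obtain ⟨c, hc, h⟩ := key (minpoly _ y)
  rw [minpoly.aeval, map_zero] at h
  have hne : Polynomial.aeval y (derivative (minpoly (IntermediateField.adjoin K S) y)) ≠ 0 :=
    (minpoly.irreducible hy.isIntegral).separable.aeval_derivative_ne_zero (minpoly.aeval _ _)
  have : D y = -c * (Polynomial.aeval y
      (derivative (minpoly (IntermediateField.adjoin K S) y)))⁻¹ := by
    field_simp
    linear_combination -h
  rw [this]
  exact M.mul_mem (M.neg_mem hc) (M.inv_mem (hev _))

end Der

section Index

/-- Indices of derivatives of the generators. -/
@[ext] structure Idx (m s : ℕ) where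
  /-- the exponent vector -/
  k : Fin m → ℕ
  /-- the index of the generator -/
  j : Fin s

variable {m s : ℕ}

/-- The key for the orderly ranking. -/
def Idx.key (p : Idx m s) : ℕ ×ₗ (Lex (Fin m → ℕ) ×ₗ Fin s) :=
  toLex (∑ i, p.k i, toLex (toLex p.k, p.j))

theorem Idx.key_injective : Function.Injective (Idx.key (m := m) (s := s)) := by
  intro p q h
  simp only [Idx.key, EmbeddingLike.apply_eq_iff_eq, Prod.mk.injEq] at h
  exact Idx.ext h.2.1 h.2.2

noncomputable instance : LinearOrder (Idx m s) := LinearOrder.lift' Idx.key Idx.key_injective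

theorem Idx.lt_iff (p q : Idx m s) : p < q ↔ p.key < q.key := Iff.rfl

instance : WellFoundedLT (Idx m s) :=
  ⟨InvImage.wf Idx.key (wellFounded_lt (α := ℕ ×ₗ (Lex (Fin m → ℕ) ×ₗ Fin s)))⟩

/-- Translation by a unit vector. -/
def Idx.up (i : Fin m) (p : Idx m s) : Idx m s := ⟨p.k + eu i, p.j⟩

theorem Idx.sum_up (i : Fin m) (p : Idx m s) : ∑ l, (p.up i).k l = ∑ l, p.k l + 1 := by
  simp [Idx.up, Finset.sum_add_distrib, sum_eu]

theorem Idx.lt_up (i : Fin m) (p : Idx m s) : p < p.up i := by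
  rw [Idx.lt_iff, Idx.key, Idx.key, Prod.Lex.toLex_lt_toLex]
  left
  rw [Idx.sum_up]
  exact Nat.lt_succ_self _

theorem Idx.up_lt_up (i : Fin m) {p q : Idx m s} (h : p < q) : p.up i < q.up i := by
  rw [Idx.lt_iff, Idx.key, Idx.key, Prod.Lex.toLex_lt_toLex] at h ⊢
  simp only [Idx.sum_up, Prod.Lex.toLex_lt_toLex] at h ⊢
  rcases h with h | ⟨h, h' | ⟨h', h''⟩⟩
  · left; omega
  · right
    refine ⟨by omega, Or.inl ?_⟩
    exact add_lt_add_left h' (toLex (eu i))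
  · right
    refine ⟨by omega, Or.inr ⟨?_, h''⟩⟩
    have : p.k = q.k := h'
    simp [Idx.up, this]

theorem Idx.isLowerSet (r : ℕ) : IsLowerSet {p : Idx m s | ∑ i, p.k i ≤ r} := by
  intro p q hqp hp
  rcases hqp.eq_or_lt with h | h
  · rw [h]; exact hp
  · rw [Idx.lt_iff, Idx.key, Idx.key, Prod.Lex.toLex_lt_toLex] at h
    have : ∑ i, q.k i ≤ ∑ i, p.k i := by
      rcases h with h | h
      · exact h.le
      · exact h.1.le
    exact le_trans this hp

/-- Splitting a set of indices by generators. -/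
def Idx.splitEquiv (E : Set (Idx m s)) (r : ℕ) :
    ↥({p : Idx m s | ∑ i, p.k i ≤ r} \ E) ≃
      Σ j : Fin s, ↥(cnt {k : Fin m → ℕ | (⟨k, j⟩ : Idx m s) ∈ E} r) where
  toFun p := ⟨p.1.j, ⟨p.1.k, p.2.2, p.2.1⟩⟩
  invFun q := ⟨⟨q.2.1, q.1⟩, q.2.2.2, q.2.2.1⟩
  left_inv _ := rfl
  right_inv _ := rfl

theorem Idx.finite_le (r : ℕ) : {p : Idx m s | ∑ i, p.k i ≤ r}.Finite := by
  have h := Idx.splitEquiv (∅ : Set (Idx m s)) r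
  have hf : ∀ j : Fin s, Finite ↥(cnt {k : Fin m → ℕ | (⟨k, j⟩ : Idx m s) ∈ (∅ : Set (Idx m s))} r) :=
    fun j => cnt_finite _ _
  have := Finite.of_equiv _ h.symm
  rw [← Set.sdiff_empty (s := {p : Idx m s | ∑ i, p.k i ≤ r})]
  exact this

theorem Idx.ncard_split (E : Set (Idx m s)) (r : ℕ) :
    ({p : Idx m s | ∑ i, p.k i ≤ r} \ E).ncard =
      ∑ j : Fin s, (cnt {k : Fin m → ℕ | (⟨k, j⟩ : Idx m s) ∈ E} r).ncard := by
  have hf : ∀ j : Fin s, Finite ↥(cnt {k : Fin m → ℕ | (⟨k, j⟩ : Idx m s) ∈ E} r) :=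
    fun j => cnt_finite _ _
  rw [← Nat.card_coe_set_eq, Nat.card_congr (Idx.splitEquiv E r), Nat.card_sigma]
  rfl

theorem isUpperSet_of_up {U : Set (Fin m → ℕ)} (hU : ∀ i, ∀ k ∈ U, k + eu i ∈ U) :
    IsUpperSet U := by
  have key : ∀ (n : ℕ) (a b : Fin m → ℕ), a ≤ b → ∑ i, b i = ∑ i, a i + n → a ∈ U → b ∈ U := by
    intro n
    induction n with
    | zero =>
      intro a b hab h ha
      have : a = b := by
        funext i
        exact (Finset.sum_eq_sum_iff_of_le (fun i _ => hab i)).1 (by simpa using h.symm) i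
          (Finset.mem_univ i)
      exact this ▸ ha
    | succ n ih =>
      intro a b hab h ha
      have : ∃ i, a i < b i := by
        by_contra! hcon
        have := Finset.sum_le_sum (s := Finset.univ) fun i _ => hcon i
        omega
      obtain ⟨i, hi⟩ := this
      refine ih (a + eu i) b ?_ ?_ (hU i a ha)
      · intro l
        by_cases hl : l = i
        · subst hl
          simp [eu]; omega
        · simpa [eu, hl] using hab l
      · simp only [Pi.add_apply, Finset.sum_add_distrib, sum_eu]
        omega
  intro a b hab ha
  have := Finset.sum_le_sum (s := Finset.univ) fun i _ => hab i
  exact key (∑ i, b i - ∑ i, a i) a b hab (by omega) ha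

end Index

theorem theta_aux {L : Type*} (m : ℕ) (f : Fin m → L → L)
    (hf : ∀ i j x, f i (f j x) = f j (f i x)) (i : Fin m) (k : Fin m → ℕ) (x : L) :
    f i ((List.ofFn fun i => (f i)^[k i]).foldr (· ∘ ·) id x) =
      (List.ofFn fun l => (f l)^[(k + eu i) l]).foldr (· ∘ ·) id x := by
  induction m with
  | zero => exact i.elim0
  | succ m ih =>
    simp only [List.ofFn_succ, List.foldr_cons, Function.comp_apply]
    refine Fin.cases ?_ (fun j => ?_) i
    · have h : ∀ l : Fin m, (k + eu (0 : Fin (m + 1)) : Fin (m + 1) → ℕ) l.succ = k l.succ := by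
        intro l; simp [eu]
      simp only [h]
      rw [show (k + eu (0 : Fin (m + 1)) : Fin (m + 1) → ℕ) 0 = k 0 + 1 by simp [eu], Function.iterate_succ_apply']
    · have h : ∀ l : Fin m, (k + eu j.succ : Fin (m + 1) → ℕ) l.succ =
          ((fun l : Fin m => k l.succ) + eu j : Fin m → ℕ) l := by
        intro l; simp [eu, Pi.single_apply]
      simp only [h]
      rw [show (k + eu j.succ : Fin (m + 1) → ℕ) 0 = k 0 by simp [eu]]
      rw [← ih (fun l => f l.succ) (fun a b x => hf _ _ x) j (fun l => k l.succ)]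
      have hc : Function.Commute (f j.succ) (f 0) := fun x => hf _ _ x
      exact hc.iterate_right (k 0) _

theorem theta_up {L : Type*} [Field L] [CharZero L] {m : ℕ} (δ : Fin m → Derivation ℚ L L)
    (hcomm : ∀ i j, ∀ x : L, δ i (δ j x) = δ j (δ i x)) (i : Fin m) (k : Fin m → ℕ) (x : L) :
    δ i (thetaApplyDer δ k x) = thetaApplyDer δ (k + eu i) x :=
  theta_aux m (fun i => ⇑(δ i)) hcomm i k x

end KolchinAux

/-- Kolchin's theorem on the differential dimension polynomial of a finitely
generated differential field extension (Theorem III.3, differential case):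
there is a polynomial `φ(t) = ∑_{i=0}^m a_i C(t+i, i)` with integer `a_i`
whose value at all sufficiently large `r` is the transcendence degree over `K`
of the field obtained from `K` by adjoining all `θ_k(η_j)` with `ord θ_k ≤ r`. -/
theorem differential_dimension_polynomial_exists
    (L : Type*) [Field L] [CharZero L] (m s : ℕ) (hm : 1 ≤ m) (hs : 1 ≤ s)
    (δ : Fin m → Derivation ℚ L L)
    (hcomm : ∀ i j, ∀ x : L, δ i (δ j x) = δ j (δ i x))
    (K : Subfield L) (hK : ∀ i, ∀ x ∈ K, δ i x ∈ K)
    (η : Fin s → L) :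
    ∃ (φ : Polynomial ℚ) (a : Fin (m + 1) → ℤ),
      φ = ∑ i : Fin (m + 1), (a i : ℚ) • binomialPoly (i : ℕ) ∧
      ∃ N : ℕ, ∀ r : ℕ, N ≤ r → ∃ d : ℕ,
        trdeg ↥K ↥(IntermediateField.adjoin ↥K
            {x : L | ∃ k : Fin m → ℕ, (∑ i, k i) ≤ r ∧
              ∃ j : Fin s, x = thetaApplyDer δ k (η j)}) = (d : Cardinal) ∧
        φ.eval (r : ℚ) = (d : ℚ) := by
  classical
  let x : KolchinAux.Idx m s → L := fun p => thetaApplyDer δ p.k (η p.j)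
  have hx : ∀ i p, δ i (x p) = x (p.up i) := fun i p =>
    KolchinAux.theta_up δ hcomm i p.k (η p.j)
  let E : Set (KolchinAux.Idx m s) := KolchinAux.dep K x
  have hE : ∀ i, ∀ p ∈ E, p.up i ∈ E := by
    intro i p hp
    have hp' : IsAlgebraic (IntermediateField.adjoin K (x '' Set.Iio p)) (x p) :=
      IntermediateField.isAlgebraic_adjoin_iff.2 hp
    have hmem : δ i (x p) ∈ IntermediateField.adjoin K (x '' Set.Iio (p.up i)) := by
      refine KolchinAux.der_algebraic (δ i) K (hK i) ?_ ?_ ?_ hp'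
      · rintro _ ⟨q, hq, rfl⟩
        exact IntermediateField.subset_adjoin _ _ ⟨q, lt_trans hq (p.lt_up i), rfl⟩
      · rintro _ ⟨q, hq, rfl⟩
        rw [hx]
        exact IntermediateField.subset_adjoin _ _ ⟨q.up i, KolchinAux.Idx.up_lt_up i hq, rfl⟩
      · exact IntermediateField.subset_adjoin _ _ ⟨p, p.lt_up i, rfl⟩
    rw [hx] at hmem
    exact IntermediateField.isAlgebraic_adjoin_iff.1 (isAlgebraic_algebraMap (A := L)
      (⟨_, hmem⟩ : IntermediateField.adjoin K (x '' Set.Iio (p.up i))))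
  let U : Fin s → UpperSet (Fin m → ℕ) := fun j =>
    ⟨{k | (⟨k, j⟩ : KolchinAux.Idx m s) ∈ E},
      KolchinAux.isUpperSet_of_up fun i k hk => hE i ⟨k, j⟩ hk⟩
  have hev := KolchinAux.EvPoly.sum Finset.univ (fun j _ => KolchinAux.cnt_evPoly m (U j))
  obtain ⟨a, N, ha⟩ := hev.exists_coeff
  refine ⟨_, fun i => a i, rfl, N, fun r hr => ?_⟩
  refine ⟨({p : KolchinAux.Idx m s | ∑ i, p.k i ≤ r} \ E).ncard, ?_, ?_⟩
  · have hset : {y : L | ∃ k : Fin m → ℕ, (∑ i, k i) ≤ r ∧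
        ∃ j : Fin s, y = thetaApplyDer δ k (η j)} =
        x '' {p : KolchinAux.Idx m s | ∑ i, p.k i ≤ r} := by
      ext y
      constructor
      · rintro ⟨k, hk, j, rfl⟩
        exact ⟨⟨k, j⟩, hk, rfl⟩
      · rintro ⟨p, hp, rfl⟩
        exact ⟨p.k, hp, p.j, rfl⟩
    rw [hset, KolchinAux.trdeg_eq_algebra_trdeg]
    exact KolchinAux.trdeg_adjoin x (KolchinAux.Idx.isLowerSet r) (KolchinAux.Idx.finite_le r)
  · have h1 := ha r hr
    rw [KolchinAux.Idx.ncard_split]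
    have h2 : ((∑ j : Fin s, (KolchinAux.cnt {k : Fin m → ℕ |
        (⟨k, j⟩ : KolchinAux.Idx m s) ∈ E} r).ncard : ℕ) : ℚ) =
        ((∑ j : Fin s, ((KolchinAux.cnt (U j : Set (Fin m → ℕ)) r).ncard : ℤ) : ℤ) : ℚ) := by
      push_cast
      rfl
    rw [h2, h1, Polynomial.eval_finsetSum, Finset.sum_range]
    push_cast
    refine Finset.sum_congr rfl fun i _ => ?_
    rw [Polynomial.eval_smul, KolchinAux.binomialPoly_eval, smul_eq_mul]
end

section
/- Let L be a field, m, s, s' ≥ 1, σ₁,…,σ_m pairwise commuting injective ring endomorphisms of L, and K a subfield of L with σᵢ(K) ⊆ K. Let η₁,…,η_s ∈ L and ζ₁,…,ζ_{s'} ∈ L be two families such that the smallest subfield of L containing K and all η_j and closed under every σᵢ coincides with the smallest subfield of L containing K and all ζ_j and closed under every σᵢ. Let φ_η(t) = ∑_{i=0}^{m} a_i C(t+i, i) and φ_ζ(t) = ∑_{i=0}^{m} b_i C(t+i, i) (with a_i, b_i ∈ ℤ) be polynomials such that for all sufficiently large r ∈ ℕ, φ_η(r) = trdeg_K K({θ_k(η_j)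 : ord θ_k ≤ r, 1 ≤ j ≤ s}) and φ_ζ(r) = trdeg_K K({θ_k(ζ_j) : ord θ_k ≤ r, 1 ≤ j ≤ s'}). Then deg φ_η = deg φ_ζ, the leading coefficients of φ_η and φ_ζ are equal, and a_m = b_m. -/
open Polynomial

set_option synthInstance.maxHeartbeats 1000000
set_option maxHeartbeats 1000000

/-- The smallest subfield of `L` containing the subfield `K` and the set `S`
and closed under every endomorphism `σ i`. -/
def diffAdjoin {L : Type*} [Field L] {m : ℕ} (σ : Fin m → (L →+* L))
    (K : Subfield L) (S : Set L) : Subfield L :=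
  sInf {F : Subfield L | K ≤ F ∧ S ⊆ ↑F ∧ ∀ i, ∀ x ∈ F, σ i x ∈ F}

/-- Peeling off the first endomorphism. -/
lemma thetaApply_succ {L : Type*} [Field L] {m : ℕ} (σ : Fin (m + 1) → (L →+* L))
    (k : Fin (m + 1) → ℕ) (x : L) :
    thetaApply σ k x = (σ 0)^[k 0] (thetaApply (fun i => σ i.succ) (fun i => k i.succ) x) := by
  simp [thetaApply, List.ofFn_succ]

lemma thetaApply_zero {L : Type*} [Field L] {m : ℕ} (σ : Fin m → (L →+* L)) (x : L) :
    thetaApply σ (fun _ => 0) x = x := by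
  induction m with
  | zero => simp [thetaApply]
  | succ m ih => rw [thetaApply_succ]; simp [ih]

lemma apply_thetaApply {L : Type*} [Field L] {m : ℕ} (σ : Fin m → (L →+* L))
    (hcomm : ∀ i j, (σ i).comp (σ j) = (σ j).comp (σ i)) (i : Fin m)
    (k : Fin m → ℕ) (x : L) :
    σ i (thetaApply σ k x) = thetaApply σ (k + Pi.single i 1) x := by
  induction m with
  | zero => exact i.elim0
  | succ m ih =>
    rw [thetaApply_succ, thetaApply_succ]
    refine Fin.cases ?_ (fun j => ?_) i
    · have h1 : (fun j : Fin m => (k + Pi.single (0 : Fin (m + 1)) 1 : Fin (m + 1) → ℕ) j.succ)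
          = fun j => k j.succ := by
        funext j; simp
      rw [h1]
      simp only [Pi.add_apply, Pi.single_eq_same, Function.iterate_succ_apply']
    · have h1 : (fun l : Fin m => (k + Pi.single (j.succ) 1 : Fin (m + 1) → ℕ) l.succ)
          = (fun l => k l.succ) + Pi.single j 1 := by
        funext l; simp [Pi.single_apply]
      have h2 : (k + Pi.single (j.succ) 1 : Fin (m + 1) → ℕ) 0 = k 0 := by
        simp [Pi.single_apply]
      rw [h1, h2, ← ih (fun i => σ i.succ) (fun i j => hcomm _ _) j]
      have hc : Function.Commute (σ j.succ) (σ 0) := fun y =>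
        DFunLike.congr_fun (hcomm j.succ 0) y
      exact (hc.iterate_right (k 0)) _

lemma thetaApply_mem {L : Type*} [Field L] {m : ℕ} (σ : Fin m → (L →+* L))
    (A : ℕ → Set L) (hA : ∀ i r, ∀ x ∈ A r, σ i x ∈ A (r + 1))
    (k : Fin m → ℕ) (h : ℕ) (x : L) (hx : x ∈ A h) :
    thetaApply σ k x ∈ A (h + ∑ i, k i) := by
  induction m with
  | zero => simpa [thetaApply] using hx
  | succ m ih =>
    rw [thetaApply_succ, Fin.sum_univ_succ]
    have h1 := ih (fun i => σ i.succ) (fun i => hA i.succ) (fun i => k i.succ)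
    have h2 : ∀ n r, ∀ y ∈ A r, (σ 0)^[n] y ∈ A (r + n) := by
      intro n
      induction n with
      | zero => intro r y hy; simpa using hy
      | succ n ihn =>
        intro r y hy
        rw [Function.iterate_succ_apply']
        exact hA 0 _ _ (ihn r y hy)
    have := h2 (k 0) _ _ h1
    convert this using 2
    omega

/-- The set of transforms of order at most `r`. -/
def orbSet {L : Type*} [Field L] {m s : ℕ} (σ : Fin m → (L →+* L)) (η : Fin s → L) (r : ℕ) :
    Set L :=
  {x : L | ∃ k : Fin m → ℕ, (∑ i, k i) ≤ r ∧ ∃ j : Fin s, x = thetaApply σ k (η j)}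

lemma orbSet_mono {L : Type*} [Field L] {m s : ℕ} (σ : Fin m → (L →+* L)) (η : Fin s → L) :
    Monotone (orbSet σ η) := by
  rintro r r' h x ⟨k, hk, j, rfl⟩
  exact ⟨k, hk.trans h, j, rfl⟩

lemma adjoin_mono_nat {L : Type*} [Field L] {m s : ℕ} (σ : Fin m → (L →+* L)) (η : Fin s → L)
    (K : Subfield L) :
    Monotone (fun r => IntermediateField.adjoin K (orbSet σ η r)) :=
  fun _ _ h => IntermediateField.adjoin.mono _ _ _ (orbSet_mono σ η h)

lemma sigma_mem {L : Type*} [Field L] {m s : ℕ} (σ : Fin m → (L →+* L))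
    (hcomm : ∀ i j, (σ i).comp (σ j) = (σ j).comp (σ i))
    (K : Subfield L) (hK : ∀ i, ∀ x ∈ K, σ i x ∈ K) (η : Fin s → L) (i : Fin m) (r : ℕ)
    (x : L) (hx : x ∈ IntermediateField.adjoin K (orbSet σ η r)) :
    σ i x ∈ IntermediateField.adjoin K (orbSet σ η (r + 1)) := by
  induction hx using IntermediateField.adjoin_induction with
  | mem x hx =>
    obtain ⟨k, hk, j, rfl⟩ := hx
    apply IntermediateField.subset_adjoin
    refine ⟨k + Pi.single i 1, ?_, j, apply_thetaApply σ hcomm i k _⟩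
    simp only [Pi.add_apply, Finset.sum_add_distrib]
    simpa using hk
  | algebraMap x =>
    exact (IntermediateField.adjoin K (orbSet σ η (r + 1))).algebraMap_mem ⟨σ i x, hK i x x.2⟩
  | add x y _ _ hx hy => rw [map_add]; exact add_mem hx hy
  | inv x _ hx => rw [map_inv₀]; exact inv_mem hx
  | mul x y _ _ hx hy => rw [map_mul]; exact mul_mem hx hy

lemma exists_mem_of_diffAdjoin {L : Type*} [Field L] {m s : ℕ} (σ : Fin m → (L →+* L))
    (hcomm : ∀ i j, (σ i).comp (σ j) = (σ j).comp (σ i))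
    (K : Subfield L) (hK : ∀ i, ∀ x ∈ K, σ i x ∈ K) (η : Fin s → L)
    (x : L) (hx : x ∈ diffAdjoin σ K (Set.range η)) :
    ∃ r, x ∈ IntermediateField.adjoin K (orbSet σ η r) := by
  have hdir : Directed (· ≤ ·)
      (fun r => (IntermediateField.adjoin K (orbSet σ η r)).toSubfield) :=
    Monotone.directed_le (fun _ _ h => adjoin_mono_nat σ η K h)
  have hle : diffAdjoin σ K (Set.range η) ≤
      ⨆ r, (IntermediateField.adjoin K (orbSet σ η r)).toSubfield := by
    refine sInf_le ⟨?_, ?_, ?_⟩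
    · intro y hy
      rw [Subfield.mem_iSup_of_directed hdir]
      exact ⟨0, (IntermediateField.adjoin K (orbSet σ η 0)).algebraMap_mem ⟨y, hy⟩⟩
    · rintro _ ⟨j, rfl⟩
      rw [SetLike.mem_coe, Subfield.mem_iSup_of_directed hdir]
      exact ⟨0, IntermediateField.subset_adjoin _ _
        ⟨fun _ => 0, by simp, j, (thetaApply_zero σ _).symm⟩⟩
    · intro i y hy
      rw [Subfield.mem_iSup_of_directed hdir] at hy ⊢
      obtain ⟨r, hr⟩ := hy
      exact ⟨r + 1, sigma_mem σ hcomm K hK η i r y hr⟩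
  have := hle hx
  rwa [Subfield.mem_iSup_of_directed hdir] at this

lemma exists_shift {L : Type*} [Field L] {m s s' : ℕ} (σ : Fin m → (L →+* L))
    (hcomm : ∀ i j, (σ i).comp (σ j) = (σ j).comp (σ i))
    (K : Subfield L) (hK : ∀ i, ∀ x ∈ K, σ i x ∈ K) (η : Fin s → L) (ζ : Fin s' → L)
    (hle : diffAdjoin σ K (Set.range ζ) ≤ diffAdjoin σ K (Set.range η)) :
    ∃ h, ∀ r, IntermediateField.adjoin K (orbSet σ ζ r) ≤
      IntermediateField.adjoin K (orbSet σ η (r + h)) := by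
  have h0 : ∀ j, ζ j ∈ diffAdjoin σ K (Set.range η) := by
    intro j
    refine hle ?_
    rw [diffAdjoin, Subfield.mem_sInf]
    rintro F ⟨-, hF, -⟩
    exact hF ⟨j, rfl⟩
  choose f hf using fun j => exists_mem_of_diffAdjoin σ hcomm K hK η _ (h0 j)
  refine ⟨∑ j, f j, fun r => ?_⟩
  rw [IntermediateField.adjoin_le_iff]
  rintro x ⟨k, hk, j, rfl⟩
  have h1 := thetaApply_mem σ
    (fun r => (IntermediateField.adjoin K (orbSet σ η r) : Set L))
    (fun i r x hx => sigma_mem σ hcomm K hK η i r x hx) k (f j) (ζ j) (hf j)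
  refine adjoin_mono_nat σ η K ?_ h1
  have : f j ≤ ∑ j, f j := Finset.single_le_sum (fun _ _ => Nat.zero_le _) (Finset.mem_univ j)
  omega

lemma trdeg_mono {K L : Type*} [Field K] [Field L] [Algebra K L] {E F : IntermediateField K L}
    (h : E ≤ F) : trdeg K E ≤ trdeg K F :=
  _root_.trdeg_le_of_injective (IntermediateField.inclusion h)
    (IntermediateField.inclusion_injective h)

lemma leadingCoeff_nonneg_of_eventually (p : ℚ[X]) (N : ℕ)
    (h : ∀ r : ℕ, N ≤ r → 0 ≤ p.eval (r : ℚ)) : 0 ≤ p.leadingCoeff := by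
  by_contra hneg
  push Not at hneg
  rcases le_or_gt p.degree 0 with hd | hd
  · have h1 := h N le_rfl
    rw [Polynomial.eq_C_of_degree_le_zero hd] at h1 hneg
    simp at h1 hneg
    linarith
  · have h1 := (p.tendsto_atBot_of_leadingCoeff_nonpos hd hneg.le).comp
      (tendsto_natCast_atTop_atTop (R := ℚ))
    have h2 := (h1.eventually (Filter.eventually_lt_atBot 0)).and (Filter.eventually_ge_atTop N)
    obtain ⟨r, hr, hN⟩ := h2.exists
    exact absurd hr (not_lt.2 (h r hN))

lemma poly_compare (p q : ℚ[X]) (N : ℕ) (hp : ∀ r : ℕ, N ≤ r → 0 ≤ p.eval (r : ℚ))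
    (h : ∀ r : ℕ, N ≤ r → p.eval (r : ℚ) ≤ q.eval (r : ℚ)) :
    p.degree ≤ q.degree ∧ (p.degree = q.degree → p.leadingCoeff ≤ q.leadingCoeff) := by
  have h0 := leadingCoeff_nonneg_of_eventually p N hp
  have h1 := leadingCoeff_nonneg_of_eventually (q - p) N (fun r hr => by
    rw [eval_sub]; linarith [h r hr])
  constructor
  · by_contra hlt
    push Not at hlt
    rw [Polynomial.leadingCoeff_sub_of_degree_lt' hlt] at h1
    have : p.leadingCoeff = 0 := by linarith
    rw [leadingCoeff_eq_zero] at this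
    subst this
    simp at hlt
  · intro he
    by_contra hlt
    push Not at hlt
    rw [Polynomial.leadingCoeff_sub_of_degree_eq he.symm hlt.ne] at h1
    linarith

lemma binomialPoly_natDegree (i : ℕ) : (binomialPoly i).natDegree = i := by
  rw [binomialPoly, natDegree_C_mul (by positivity),
    natDegree_prod_of_monic _ _ (fun j _ => monic_X_add_C _)]
  simp only [natDegree_X_add_C, Finset.sum_const, Finset.card_range, smul_eq_mul, mul_one]

lemma coeff_sum_binomialPoly (m : ℕ) (a : Fin (m + 1) → ℤ) :
    (∑ i : Fin (m + 1), (a i : ℚ) • binomialPoly (i : ℕ)).coeff m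
      = a (Fin.last m) * (binomialPoly m).coeff m := by
  rw [finsetSum_coeff, Fin.sum_univ_castSucc]
  rw [Finset.sum_eq_zero]
  · simp
  · intro i _
    rw [coeff_smul, coeff_eq_zero_of_natDegree_lt, smul_zero]
    rw [binomialPoly_natDegree]
    exact i.2

lemma natDegree_sum_binomialPoly (m : ℕ) (a : Fin (m + 1) → ℤ) :
    (∑ i : Fin (m + 1), (a i : ℚ) • binomialPoly (i : ℕ)).natDegree ≤ m := by
  refine natDegree_sum_le_of_forall_le _ _ (fun i _ => ?_)
  refine (natDegree_smul_le _ _).trans ?_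
  rw [binomialPoly_natDegree]
  exact Nat.lt_succ_iff.1 i.2

lemma binomialPoly_coeff_ne (m : ℕ) : (binomialPoly m).coeff m ≠ 0 := by
  have h : (binomialPoly m).coeff m = (binomialPoly m).leadingCoeff := by
    rw [leadingCoeff, binomialPoly_natDegree]
  rw [h, leadingCoeff_ne_zero, binomialPoly]
  refine mul_ne_zero (C_ne_zero.2 (by positivity)) ?_
  exact (monic_prod_of_monic _ _ (fun j _ => monic_X_add_C _)).ne_zero

lemma one_side {L : Type*} [Field L] {m s s' : ℕ} (σ : Fin m → (L →+* L))
    (hcomm : ∀ i j, (σ i).comp (σ j) = (σ j).comp (σ i))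
    (K : Subfield L) (hK : ∀ i, ∀ x ∈ K, σ i x ∈ K) (η : Fin s → L) (ζ : Fin s' → L)
    (hle : diffAdjoin σ K (Set.range ζ) ≤ diffAdjoin σ K (Set.range η))
    (φη φζ : Polynomial ℚ)
    (hη : ∃ N : ℕ, ∀ r : ℕ, N ≤ r → ∃ d : ℕ,
      trdeg ↥K ↥(IntermediateField.adjoin ↥K (orbSet σ η r)) = (d : Cardinal) ∧
      φη.eval (r : ℚ) = (d : ℚ))
    (hζ : ∃ N : ℕ, ∀ r : ℕ, N ≤ r → ∃ d : ℕ,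
      trdeg ↥K ↥(IntermediateField.adjoin ↥K (orbSet σ ζ r)) = (d : Cardinal) ∧
      φζ.eval (r : ℚ) = (d : ℚ)) :
    φζ.degree ≤ φη.degree ∧ (φζ.degree = φη.degree → φζ.leadingCoeff ≤ φη.leadingCoeff) := by
  obtain ⟨h, hh⟩ := exists_shift σ hcomm K hK η ζ hle
  obtain ⟨N, hN⟩ := hη
  obtain ⟨M, hM⟩ := hζ
  have key := poly_compare φζ (taylor (h : ℚ) φη) (max N M) ?_ ?_
  · rwa [degree_taylor, leadingCoeff_taylor] at key
  · intro r hr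
    obtain ⟨d, -, h2⟩ := hM r (le_of_max_le_right hr)
    rw [h2]; positivity
  · intro r hr
    obtain ⟨d, h1, h2⟩ := hM r (le_of_max_le_right hr)
    obtain ⟨e, h3, h4⟩ := hN (r + h) ((le_of_max_le_left hr).trans (Nat.le_add_right _ _))
    have h5 := trdeg_mono (hh r)
    rw [h1, h3] at h5
    rw [taylor_eval, h2, ← Nat.cast_add, h4]
    exact_mod_cast h5

/-- Invariance of the difference dimension polynomial (Theorem III.3(iii)):
if two finite families `η`, `ζ` generate the same difference field extension of
`K`, then the associated dimension polynomials have the same degree, the same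
leading coefficient, and the same top coefficient `a_m = b_m` in their
expansions in binomial polynomials. -/
theorem difference_dimension_polynomial_invariants
    (L : Type*) [Field L] (m s s' : ℕ) (hm : 1 ≤ m) (hs : 1 ≤ s) (hs' : 1 ≤ s')
    (σ : Fin m → (L →+* L))
    (hinj : ∀ i, Function.Injective (σ i))
    (hcomm : ∀ i j, (σ i).comp (σ j) = (σ j).comp (σ i))
    (K : Subfield L) (hK : ∀ i, ∀ x ∈ K, σ i x ∈ K)
    (η : Fin s → L) (ζ : Fin s' → L)
    (hgen : diffAdjoin σ K (Set.range η) = diffAdjoin σ K (Set.range ζ))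
    (φη φζ : Polynomial ℚ) (a b : Fin (m + 1) → ℤ)
    (hφη : φη = ∑ i : Fin (m + 1), (a i : ℚ) • binomialPoly (i : ℕ))
    (hφζ : φζ = ∑ i : Fin (m + 1), (b i : ℚ) • binomialPoly (i : ℕ))
    (hη : ∃ N : ℕ, ∀ r : ℕ, N ≤ r → ∃ d : ℕ,
      trdeg ↥K ↥(IntermediateField.adjoin ↥K
          {x : L | ∃ k : Fin m → ℕ, (∑ i, k i) ≤ r ∧
            ∃ j : Fin s, x = thetaApply σ k (η j)}) = (d : Cardinal) ∧
      φη.eval (r : ℚ) = (d : ℚ))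
    (hζ : ∃ N : ℕ, ∀ r : ℕ, N ≤ r → ∃ d : ℕ,
      trdeg ↥K ↥(IntermediateField.adjoin ↥K
          {x : L | ∃ k : Fin m → ℕ, (∑ i, k i) ≤ r ∧
            ∃ j : Fin s', x = thetaApply σ k (ζ j)}) = (d : Cardinal) ∧
      φζ.eval (r : ℚ) = (d : ℚ)) :
    φη.degree = φζ.degree ∧ φη.leadingCoeff = φζ.leadingCoeff ∧
      a (Fin.last m) = b (Fin.last m) := by
  have h1 := one_side σ hcomm K hK η ζ hgen.ge φη φζ hη hζ
  have h2 := one_side σ hcomm K hK ζ η hgen.le φζ φη hζ hη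
  have hd : φη.degree = φζ.degree := le_antisymm h2.1 h1.1
  have hl : φη.leadingCoeff = φζ.leadingCoeff := le_antisymm (h2.2 hd) (h1.2 hd.symm)
  refine ⟨hd, hl, ?_⟩
  have hnd : φη.natDegree = φζ.natDegree := natDegree_eq_of_degree_eq hd
  have hc : φη.coeff m = φζ.coeff m := by
    have hmη : φη.natDegree ≤ m := hφη ▸ natDegree_sum_binomialPoly m a
    rcases hmη.eq_or_lt with he | hlt
    · rw [leadingCoeff, leadingCoeff, ← hnd, he] at hl
      exact hl
    · rw [coeff_eq_zero_of_natDegree_lt hlt, coeff_eq_zero_of_natDegree_lt (hnd ▸ hlt)]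
  rw [hφη, hφζ, coeff_sum_binomialPoly, coeff_sum_binomialPoly] at hc
  exact_mod_cast mul_right_cancel₀ (binomialPoly_coeff_ne m) hc
end

section
/- Let L be a field, m, s ≥ 1, σ₁,…,σ_m pairwise commuting ring automorphisms of L, and K a subfield of L with σᵢ(K) ⊆ K and σᵢ^{−1}(K) ⊆ K for all i. Let η₁,…,η_s ∈ L and suppose the family of all elements σ₁^{k₁}∘⋯∘σ_m^{k_m}(η_j), where (k₁,…,k_m) ranges over ℤ^m and 1 ≤ j ≤ s, is algebraically independent over K. Then for every r ∈ ℕ, the transcendence degree over K of the subfield of L generated over K by {σ₁^{k₁}∘⋯∘σ_m^{k_m}(η_j) : |k₁|+⋯+|k_m| ≤ r, 1 ≤ j ≤ s} equals s · ∑_{k=0}^{m} (−1)^{m−k} · 2^k · C(m, k) · C(r+k, k). -/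
set_option synthInstance.maxHeartbeats 1000000
set_option maxHeartbeats 1000000

/-- `γ_k = σ₁^{k₁} ∘ ⋯ ∘ σ_m^{k_m}` (integer exponents) for a family of
automorphisms `σ`. -/
def gammaApply {L : Type*} [Field L] {m : ℕ} (σ : Fin m → RingAut L)
    (k : Fin m → ℤ) : L → L :=
  (List.ofFn fun i => ⇑(σ i ^ k i)).foldr (· ∘ ·) id

def dimPoly (m r : ℕ) : ℤ := ∑ k ∈ Finset.range (m + 1),
        (-1 : ℤ) ^ (m - k) * 2 ^ k * (m.choose k) * ((r + k).choose k)

lemma dimPoly_rec (m r : ℕ) : dimPoly (m+1) r = 2 * ∑ t ∈ Finset.range (r+1), dimPoly m t - dimPoly m r := by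
  have h1 : ∑ t ∈ Finset.range (r+1), dimPoly m t = ∑ k ∈ Finset.range (m + 1),
        (-1 : ℤ) ^ (m - k) * 2 ^ k * (m.choose k) * ((r + (k+1)).choose (k+1)) := by
    unfold dimPoly
    rw [Finset.sum_comm]
    refine Finset.sum_congr rfl fun k _ => ?_
    rw [← Finset.mul_sum]
    congr 1
    have := Nat.sum_range_add_choose r k
    rw [← add_assoc, ← this]
    push_cast
    rfl
  have h2 : dimPoly m r = ∑ k ∈ Finset.range (m + 2),
        (-1 : ℤ) ^ (m - k) * 2 ^ k * (m.choose k) * ((r + k).choose k) := by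
    rw [Finset.sum_range_succ]; simp [dimPoly]
  rw [h1, h2]
  unfold dimPoly
  rw [Finset.sum_range_succ', Finset.sum_range_succ' _ (m+1), Finset.mul_sum, sub_add_eq_sub_sub,
    ← Finset.sum_sub_distrib, sub_eq_add_neg]
  congr 1
  · refine Finset.sum_congr rfl fun k hk => ?_
    have hk : k < m + 1 := Finset.mem_range.1 hk
    rw [Nat.choose_succ_succ m k, Nat.add_sub_add_right]
    rcases eq_or_lt_of_le (Nat.lt_succ_iff.1 hk) with rfl | h
    · simp; ring
    · obtain ⟨d, rfl⟩ := Nat.exists_eq_add_of_lt h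
      have e1 : k + d + 1 - k = d + 1 := by omega
      have e2 : k + d + 1 - (k+1) = d := by omega
      rw [e1, e2]; push_cast; ring
  · simp [pow_succ]

lemma sum_abs (g : ℕ → ℤ) (r : ℕ) : ∑ a ∈ Finset.Icc (-(r:ℤ)) r, g a.natAbs =
    2 * ∑ t ∈ Finset.range (r+1), g t - g 0 := by
  induction r with
  | zero => simp; ring
  | succ r ih =>
    have : Finset.Icc (-((r+1:ℕ):ℤ)) ((r+1:ℕ):ℤ) =
      insert ((r+1:ℕ):ℤ) (insert (-((r+1:ℕ):ℤ)) (Finset.Icc (-(r:ℤ)) r)) := by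
      ext x; simp only [Finset.mem_Icc, Finset.mem_insert]; omega
    rw [this, Finset.sum_insert, Finset.sum_insert, ih, Finset.sum_range_succ _ (r+1),
      Int.natAbs_neg, Int.natAbs_natCast]
    · ring
    · simp only [Finset.mem_Icc]; omega
    · simp only [Finset.mem_Icc, Finset.mem_insert]; omega

lemma count (m : ℕ) : ∀ r : ℕ, ∃ B : Finset (Fin m → ℤ),
    (∀ k, k ∈ B ↔ ∑ i, (k i).natAbs ≤ r) ∧ (B.card : ℤ) = dimPoly m r := by
  induction m with
  | zero => intro r; exact ⟨Finset.univ, fun k => by simp [Finset.mem_univ, -Finset.univ_unique], by simp [dimPoly]⟩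
  | succ m ih =>
    intro r
    choose B hB hc using ih
    refine ⟨((Finset.Icc (-(r:ℤ)) r).sigma fun a => B (r - a.natAbs)).map
      ⟨fun p => (Fin.cons p.1 p.2 : Fin (m+1) → ℤ), ?_⟩, ?_, ?_⟩
    · rintro ⟨a, f⟩ ⟨b, g⟩ h
      obtain ⟨h1, h2⟩ := Fin.cons_injective2 h
      subst h1 h2; rfl
    · intro k
      simp only [Finset.mem_map, Finset.mem_sigma, Finset.mem_Icc, hB,
        Fin.sum_univ_succ]
      constructor
      · rintro ⟨⟨a, f⟩, ⟨h1, h2⟩, rfl⟩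
        change (a.natAbs + ∑ i, (f i).natAbs) ≤ r
        dsimp only at h1 h2
        omega
      · intro h
        refine ⟨⟨k 0, Fin.tail k⟩, ⟨by dsimp only; omega, ?_⟩, Fin.cons_self_tail k⟩
        simp only [Fin.tail]; omega
    · rw [Finset.card_map, Finset.card_sigma]
      push_cast
      simp only [hc]
      rw [sum_abs (fun t => dimPoly m (r - t)) r, dimPoly_rec, ← Finset.sum_range_reflect]
      have : ∑ x ∈ Finset.range (r + 1), dimPoly m (r - (r + 1 - 1 - x)) =
          ∑ t ∈ Finset.range (r + 1), dimPoly m t := by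
        refine Finset.sum_congr rfl fun x hx => ?_
        have := Finset.mem_range.1 hx
        congr 1
        omega
      rw [this]
      simp

lemma trdeg_adjoin_of_indep {F E : Type*} [Field F] [Field E] [Algebra F E] {ι : Type}
    [Fintype ι] {x : ι → E} (hx : AlgebraicIndependent F x) :
    Algebra.trdeg F (IntermediateField.adjoin F (Set.range x)) = (Fintype.card ι : Cardinal) := by
  have : Algebra.IsAlgebraic (MvPolynomial ι F) (FractionRing (MvPolynomial ι F)) :=
    IsLocalization.isAlgebraic _ (nonZeroDivisors (MvPolynomial ι F))
  have h1 := (IsTranscendenceBasis.mvPolynomial ι F).algebraMap_comp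
    (A := FractionRing (MvPolynomial ι F))
  have h2 := hx.aevalEquivField.isTranscendenceBasis h1
  have h3 := h2.lift_cardinalMk_eq_trdeg
  rw [Cardinal.mk_fintype, Cardinal.lift_natCast] at h3
  simpa using h3.symm

/-- Theorem III.4(iv): if `η₁,…,η_s` are inversive-difference algebraically
independent over `K`, then for every `r` the transcendence degree over `K` of
the field generated by the transforms `γ_k(η_j)` with `ord γ_k ≤ r` equals
`s · ∑_{k=0}^{m} (−1)^{m−k} 2^k C(m, k) C(r+k, k)`. -/
theorem inversive_difference_dimension_polynomial_of_independent
    (L : Type*) [Field L] (m s : ℕ) (hm : 1 ≤ m) (hs : 1 ≤ s)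
    (σ : Fin m → RingAut L)
    (hcomm : ∀ i j, σ i * σ j = σ j * σ i)
    (K : Subfield L) (hK : ∀ i, ∀ x ∈ K, σ i x ∈ K)
    (hK' : ∀ i, ∀ x ∈ K, (σ i)⁻¹ x ∈ K)
    (η : Fin s → L)
    (hind : AlgebraicIndependent ↥K
      (fun p : (Fin m → ℤ) × Fin s => gammaApply σ p.1 (η p.2))) :
    ∀ r : ℕ, ∃ d : ℕ,
      trdeg ↥K ↥(IntermediateField.adjoin ↥K
          {x : L | ∃ k : Fin m → ℤ, (∑ i, (k i).natAbs) ≤ r ∧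
            ∃ j : Fin s, x = gammaApply σ k (η j)}) = (d : Cardinal) ∧
      (d : ℤ) = s * ∑ k ∈ Finset.range (m + 1),
        (-1 : ℤ) ^ (m - k) * 2 ^ k * (m.choose k) * ((r + k).choose k) := by
  intro r
  obtain ⟨B, hB, hc⟩ := count m r
  refine ⟨Fintype.card (B × Fin s), ?_, ?_⟩
  · have hi := hind.comp (fun p : B × Fin s => ((p.1 : Fin m → ℤ), p.2)) (by
      rintro ⟨a, b⟩ ⟨c, d⟩ h
      simp only [Prod.mk.injEq] at h
      exact Prod.ext (Subtype.ext h.1) h.2)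
    have hS : {x : L | ∃ k : Fin m → ℤ, (∑ i, (k i).natAbs) ≤ r ∧
            ∃ j : Fin s, x = gammaApply σ k (η j)} =
        Set.range ((fun p : (Fin m → ℤ) × Fin s => gammaApply σ p.1 (η p.2)) ∘
          (fun p : B × Fin s => ((p.1 : Fin m → ℤ), p.2))) := by
      ext x
      constructor
      · rintro ⟨k, hk, j, rfl⟩
        exact ⟨(⟨k, (hB k).2 hk⟩, j), rfl⟩
      · rintro ⟨⟨⟨k, hk⟩, j⟩, rfl⟩
        exact ⟨k, (hB k).1 hk, j, rfl⟩
    rw [hS]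
    exact trdeg_adjoin_of_indep hi
  · rw [Fintype.card_prod, Fintype.card_coe, Fintype.card_fin]
    push_cast
    rw [hc, mul_comm]
    rfl
end

section
/- Let n ≥ 1 and q ≥ 1 be natural numbers, and for each i ∈ {1,…,q} let p_i ∈ ℕ and w_{i,1},…,w_{i,p_i} ∈ ℕ^n be given vectors. For a subset ξ ⊆ {1,…,p_i}, let λ_{i,ξ} ∈ ℕ^n be the componentwise maximum of the vectors w_{i,j} for j ∈ ξ (with λ_{i,∅} the zero vector), and let f_{i,ξ} be the sum of the n components of λ_{i,ξ}. Then for every r ∈ ℕ, the number of pairs (i, v) with i ∈ {1,…,q} and v ∈ ℕ^n such that the sum of the components of v is at most r and no j ∈ {1,…,p_i} satisfies w_{i,j} ≤ v componentwise, equals ∑_{i=1}^{q} ∑_{l=0}^{p_i} (−1)^l ∑_{ξ ∈ A(l, p_i)} C(r + n − f_{i,ξ}, n), where A(l, p_i) is the collection of l-element subsets of {1,…,p_i}, and the term C(r + n − f_{i,ξ}, n) is taken to be 0 whenever r + n − f_{i,ξ} < n (in particular whenever f_{i,ξ} > r). -/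
/-- Exponent vectors of order at most `s`. -/
def termBox (n s : ℕ) : Finset (Fin n → ℕ) :=
  (Fintype.piFinset fun _ : Fin n => Finset.range (s + 1)).filter fun v => ∑ t, v t ≤ s

theorem mem_termBox {n s : ℕ} {v : Fin n → ℕ} : v ∈ termBox n s ↔ ∑ t, v t ≤ s := by
  simp only [termBox, Finset.mem_filter, Fintype.mem_piFinset, Finset.mem_range]
  refine ⟨fun h => h.2, fun h => ⟨fun t => ?_, h⟩⟩
  have := Finset.single_le_sum (f := v) (fun _ _ => Nat.zero_le _) (Finset.mem_univ t)
  omega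

theorem card_termBox (n s : ℕ) (hn : 1 ≤ n) : (termBox n s).card = (s + n).choose n := by
  obtain ⟨m, rfl⟩ : ∃ m, n = m + 1 := ⟨n - 1, by omega⟩
  rw [Finset.card_eq_sum_card_fiberwise (f := fun v => ∑ t, v t) (t := Finset.range (s + 1))]
  · rw [← add_assoc, ← Nat.sum_range_add_choose s m]
    refine Finset.sum_congr rfl fun k hk => ?_
    have h1 := Finset.card_finsuppAntidiag_nat_eq_choose
      (s := (Finset.univ : Finset (Fin (m + 1)))) k
    have h2 : (m + 1 + k - 1).choose k = (k + m).choose m := by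
      rw [show m + 1 + k - 1 = k + m by omega]
      exact (Nat.choose_symm_add (a := k) (b := m))
    rw [Finset.card_univ, Fintype.card_fin, h2] at h1
    rw [← h1]
    symm
    refine Finset.card_bij (fun f _ => (f : Fin (m + 1) → ℕ)) ?_ ?_ ?_
    · intro f hf
      have h3 : ∑ t, f t = k := (Finset.mem_finsuppAntidiag.1 hf).1
      have h4 := Finset.mem_range.1 hk
      rw [Finset.mem_filter, mem_termBox]
      exact ⟨by rw [h3]; omega, h3⟩
    · intro f _ g _ h
      exact DFunLike.coe_injective h
    · intro v hv
      refine ⟨Finsupp.equivFunOnFinite.symm v, ?_, by simp⟩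
      simp only [Finset.mem_filter] at hv
      simpa [Finset.mem_finsuppAntidiag] using hv.2
  · intro v hv
    have := mem_termBox.1 hv
    simp
    omega

theorem card_termBox_ge (n r : ℕ) (hn : 1 ≤ n) (a : Fin n → ℕ) :
    ((termBox n r).filter fun v => ∀ t, a t ≤ v t).card = (r + n - ∑ t, a t).choose n := by
  by_cases h : ∑ t, a t ≤ r
  · rw [show r + n - ∑ t, a t = (r - ∑ t, a t) + n by omega, ← card_termBox n _ hn]
    symm
    refine Finset.card_bij (fun v _ => v + a) ?_ ?_ ?_
    · intro v hv
      have := mem_termBox.1 hv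
      simp only [Finset.mem_filter, mem_termBox, Pi.add_apply, Finset.sum_add_distrib]
      exact ⟨by omega, fun t => by omega⟩
    · intro v _ u _ h
      exact add_right_cancel h
    · intro v hv
      simp only [Finset.mem_filter, mem_termBox] at hv
      have e : v - a + a = v := by
        funext t
        have := hv.2 t
        simp only [Pi.add_apply, Pi.sub_apply]
        omega
      refine ⟨v - a, ?_, e⟩
      have e2 : ∑ t, (v - a) t + ∑ t, a t = ∑ t, v t := by
        rw [← Finset.sum_add_distrib]
        exact Finset.sum_congr rfl fun t _ => congrFun e t
      rw [mem_termBox]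
      omega
  · rw [Nat.choose_eq_zero_of_lt (by omega), Finset.card_eq_zero, Finset.filter_eq_empty_iff]
    intro v hv hle
    have := mem_termBox.1 hv
    have := Finset.sum_le_sum (fun t (_ : t ∈ Finset.univ) => hle t)
    omega

theorem card_irreducible_one (n r k : ℕ) (hn : 1 ≤ n) (w : Fin k → Fin n → ℕ) :
    (((termBox n r).filter fun v => ∀ j, ¬ ∀ t, w j t ≤ v t).card : ℤ) =
      ∑ l ∈ Finset.range (k + 1), (-1 : ℤ) ^ l *
        ∑ ξ ∈ Finset.powersetCard l (Finset.univ : Finset (Fin k)),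
          (((r + n - ∑ t, ξ.sup fun j => w j t).choose n : ℕ) : ℤ) := by
  have key : ∀ v : Fin n → ℕ, (if ∀ j, ¬ ∀ t, w j t ≤ v t then (1 : ℤ) else 0) =
      ∑ ξ ∈ (Finset.univ : Finset (Fin k)).powerset, (-1 : ℤ) ^ ξ.card *
        if ∀ t, (ξ.sup fun j => w j t) ≤ v t then 1 else 0 := by
    intro v
    have h1 := Finset.prod_one_add (f := fun j => -(if ∀ t, w j t ≤ v t then (1 : ℤ) else 0))
      (Finset.univ : Finset (Fin k))
    have h2 : ∏ j : Fin k, (1 + -(if ∀ t, w j t ≤ v t then (1 : ℤ) else 0)) =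
        if ∀ j, ¬ ∀ t, w j t ≤ v t then (1 : ℤ) else 0 := by
      by_cases h : ∀ j, ¬ ∀ t, w j t ≤ v t
      · rw [if_pos h]
        refine Finset.prod_eq_one fun j _ => ?_
        rw [if_neg (h j)]; norm_num
      · rw [if_neg h]
        push Not at h
        obtain ⟨j, hj⟩ := h
        refine Finset.prod_eq_zero (Finset.mem_univ j) ?_
        rw [if_pos hj]; norm_num
    rw [← h2, h1]
    refine Finset.sum_congr rfl fun ξ _ => ?_
    rw [Finset.prod_neg]
    congr 1
    by_cases h : ∀ t, (ξ.sup fun j => w j t) ≤ v t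
    · rw [if_pos h]
      refine Finset.prod_eq_one fun j hj => ?_
      rw [if_pos fun t => Finset.sup_le_iff.1 (h t) j hj]
    · rw [if_neg h]
      simp only [Finset.sup_le_iff] at h
      push Not at h
      obtain ⟨t, j, hj, hlt⟩ := h
      refine Finset.prod_eq_zero hj ?_
      rw [if_neg fun h' => absurd (h' t) (not_le.2 hlt)]
  rw [Finset.card_filter]
  push_cast
  rw [Finset.sum_congr rfl fun v _ => key v, Finset.sum_comm, Finset.sum_powerset,
    Finset.card_univ, Fintype.card_fin]
  refine Finset.sum_congr rfl fun l _ => ?_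
  rw [Finset.mul_sum]
  refine Finset.sum_congr rfl fun ξ hξ => ?_
  rw [← Finset.mul_sum, (Finset.mem_powersetCard.1 hξ).2, ← card_termBox_ge n r hn,
    Finset.card_filter]
  push_cast
  rfl

/-- Inclusion–exclusion formula (Proposition IV.7) for the number of terms of
order at most `r` on each of `q` free generators that are irreducible modulo a
family of leading terms: the pair `(i, v)` is counted when `∑ v ≤ r` and no
exponent vector `w i j` divides `v` componentwise; the count equals
`∑_{i=1}^{q} ∑_{l=0}^{p_i} (−1)^l ∑_{ξ ∈ A(l, p_i)} C(r + n − f_{i,ξ}, n)`,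
where `f_{i,ξ}` is the sum of the components of the componentwise maximum of
`{w i j : j ∈ ξ}` (the binomial coefficient vanishing when `r + n − f_{i,ξ} < n`,
as happens with truncated subtraction). -/
theorem count_irreducible_terms
    (n q : ℕ) (hn : 1 ≤ n) (hq : 1 ≤ q)
    (p : Fin q → ℕ) (w : (i : Fin q) → Fin (p i) → (Fin n → ℕ)) (r : ℕ) :
    (Nat.card {iv : Fin q × (Fin n → ℕ) //
        (∑ t, iv.2 t) ≤ r ∧ ∀ j : Fin (p iv.1), ¬ (∀ t, w iv.1 j t ≤ iv.2 t)} : ℤ) =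
      ∑ i : Fin q, ∑ l ∈ Finset.range (p i + 1), (-1 : ℤ) ^ l *
        ∑ ξ ∈ Finset.powersetCard l (Finset.univ : Finset (Fin (p i))),
          (((r + n - ∑ t, ξ.sup fun j => w i j t).choose n : ℕ) : ℤ) := by
  rw [← Finset.sum_congr rfl fun i _ => card_irreducible_one n r (p i) hn (w i)]
  rw [← Nat.cast_sum, ← Finset.card_sigma, ← Nat.card_eq_finsetCard]
  congr 1
  refine Nat.card_congr ((Equiv.sigmaEquivProd (Fin q) (Fin n → ℕ)).symm.subtypeEquiv ?_)
  rintro ⟨i, v⟩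
  simp [mem_termBox]
end

section
/- For every natural number r ≥ 1, the number of quadruples (a_x, a_t, b_x, b_t) ∈ ℕ⁴ with a_x + a_t + b_x + b_t ≤ r satisfying none of the following six conditions: (1) a_x ≥ 2; (2) a_x ≥ 1 and b_x ≥ 1; (3) a_t ≥ 1 and b_t ≥ 1; (4) a_t ≥ 1 and b_x ≥ 1; (5) a_x ≥ 1 and b_t ≥ 1; (6) b_x ≥ 2 and b_t ≥ 1; equals 5r. -/
/-- Enumeration of the five one-parameter families of irreducible terms. -/
def diffusionFamily (r : ℕ) : Fin r ⊕ Fin r ⊕ Fin r ⊕ Fin r ⊕ Fin r → ℕ × ℕ × ℕ × ℕ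
  | .inl i => (1, i.1, 0, 0)
  | .inr (.inl i) => (0, i.1 + 1, 0, 0)
  | .inr (.inr (.inl i)) => (0, 0, i.1 + 1, 0)
  | .inr (.inr (.inr (.inl i))) => (0, 0, 0, i.1 + 1)
  | .inr (.inr (.inr (.inr i))) => (0, 0, if i.1 = 0 then 0 else 1, i.1)

/-- The inversive difference dimension polynomial of the forward difference
scheme for the diffusion equation: for `r ≥ 1`, the number of quadruples
`(a_x, a_t, b_x, b_t)` of natural numbers with `a_x + a_t + b_x + b_t ≤ r` that
are divisible by none of the six leading terms equals `5r`. -/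
theorem diffusion_forward_scheme_dimension (r : ℕ) (hr : 1 ≤ r) :
    Nat.card {k : ℕ × ℕ × ℕ × ℕ //
        k.1 + k.2.1 + k.2.2.1 + k.2.2.2 ≤ r ∧
        ¬ (2 ≤ k.1) ∧
        ¬ (1 ≤ k.1 ∧ 1 ≤ k.2.2.1) ∧
        ¬ (1 ≤ k.2.1 ∧ 1 ≤ k.2.2.2) ∧
        ¬ (1 ≤ k.2.1 ∧ 1 ≤ k.2.2.1) ∧
        ¬ (1 ≤ k.1 ∧ 1 ≤ k.2.2.2) ∧
        ¬ (2 ≤ k.2.2.1 ∧ 1 ≤ k.2.2.2)} = 5 * r := by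
  have hf : ∀ s, diffusionFamily r s ∈ {k : ℕ × ℕ × ℕ × ℕ |
        k.1 + k.2.1 + k.2.2.1 + k.2.2.2 ≤ r ∧
        ¬ (2 ≤ k.1) ∧
        ¬ (1 ≤ k.1 ∧ 1 ≤ k.2.2.1) ∧
        ¬ (1 ≤ k.2.1 ∧ 1 ≤ k.2.2.2) ∧
        ¬ (1 ≤ k.2.1 ∧ 1 ≤ k.2.2.1) ∧
        ¬ (1 ≤ k.1 ∧ 1 ≤ k.2.2.2) ∧
        ¬ (2 ≤ k.2.2.1 ∧ 1 ≤ k.2.2.2)} := by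
    rintro (i | i | i | i | i) <;> have hi := i.2 <;>
      simp only [diffusionFamily, Set.mem_ofPred_eq] <;> (try split_ifs) <;> omega
  have hb : Function.Bijective (fun s => (⟨diffusionFamily r s, hf s⟩ : {k : ℕ × ℕ × ℕ × ℕ //
        k.1 + k.2.1 + k.2.2.1 + k.2.2.2 ≤ r ∧
        ¬ (2 ≤ k.1) ∧
        ¬ (1 ≤ k.1 ∧ 1 ≤ k.2.2.1) ∧
        ¬ (1 ≤ k.2.1 ∧ 1 ≤ k.2.2.2) ∧
        ¬ (1 ≤ k.2.1 ∧ 1 ≤ k.2.2.1) ∧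
        ¬ (1 ≤ k.1 ∧ 1 ≤ k.2.2.2) ∧
        ¬ (2 ≤ k.2.2.1 ∧ 1 ≤ k.2.2.2)})) := by
    constructor
    · intro s t h
      have h' : diffusionFamily r s = diffusionFamily r t := congrArg Subtype.val h
      clear h
      rcases s with (i | i | i | i | i) <;> rcases t with (j | j | j | j | j) <;>
        simp only [diffusionFamily, Prod.mk.injEq] at h' <;>
        first
        | (exfalso; by_cases hi : i.1 = 0 <;> by_cases hj : j.1 = 0 <;>
            simp only [hi, hj, if_true, if_false] at h' <;> omega)
        | (exfalso; omega)
        | (exfalso; obtain ⟨-, -, h1, h2⟩ := h'; rw [if_pos h2] at h1; omega)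
        | (have hij : i = j := Fin.ext (by omega)
           rw [hij])
    · rintro ⟨⟨a, b, c, d⟩, h⟩
      simp only at h
      have key : ∃ s, diffusionFamily r s = (a, b, c, d) := by
        by_cases ha : a = 1
        · exact ⟨.inl ⟨b, by omega⟩, by simp [diffusionFamily]; omega⟩
        by_cases hb : 1 ≤ b
        · exact ⟨.inr (.inl ⟨b - 1, by omega⟩), by simp [diffusionFamily]; omega⟩
        by_cases hd : d = 0
        · by_cases hc : c = 0
          · exact ⟨.inr (.inr (.inr (.inr ⟨0, by omega⟩))), by simp [diffusionFamily]; omega⟩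
          · exact ⟨.inr (.inr (.inl ⟨c - 1, by omega⟩)), by simp [diffusionFamily]; omega⟩
        · by_cases hc : c = 0
          · exact ⟨.inr (.inr (.inr (.inl ⟨d - 1, by omega⟩))), by simp [diffusionFamily]; omega⟩
          · exact ⟨.inr (.inr (.inr (.inr ⟨d, by omega⟩))), by simp [diffusionFamily, hd]; omega⟩
      obtain ⟨s, hs⟩ := key
      exact ⟨s, Subtype.ext hs⟩
  rw [← Nat.card_eq_of_bijective _ hb]
  simp only [Nat.card_eq_fintype_card, Fintype.card_sum, Fintype.card_fin]
  omega
end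

section
/- For every natural number r ≥ 1, the number of quadruples (a_x, a_t, b_x, b_t) ∈ ℕ⁴ with a_x + a_t + b_x + b_t ≤ r satisfying none of the following four conditions: (1) b_x ≥ 2 and b_t ≥ 1; (2) a_t ≥ 1 and b_x ≥ 1; (3) a_t ≥ 1 and b_t ≥ 1; (4) a_x ≥ 1; equals 4r. -/
/-- Enumeration of the admissible quadruples by `{0,1,2,3} × {0,…,r-1}`. -/
def quadEnum (p : ℕ × ℕ) : ℕ × ℕ × ℕ × ℕ :=
  if p.1 = 0 then (0, p.2 + 1, 0, 0)
  else if p.1 = 1 then (0, 0, p.2 + 1, 0)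
  else if p.1 = 2 then (0, 0, 0, p.2 + 1)
  else if p.2 = 0 then (0, 0, 0, 0) else (0, 0, 1, p.2)

/-- The inversive difference dimension polynomial of the symmetric difference
scheme for the diffusion equation: for `r ≥ 1`, the number of quadruples
`(a_x, a_t, b_x, b_t)` of natural numbers with `a_x + a_t + b_x + b_t ≤ r` that
are divisible by none of the four leading terms equals `4r`. -/
theorem diffusion_symmetric_scheme_dimension (r : ℕ) (hr : 1 ≤ r) :
    Nat.card {k : ℕ × ℕ × ℕ × ℕ //
        k.1 + k.2.1 + k.2.2.1 + k.2.2.2 ≤ r ∧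
        ¬ (2 ≤ k.2.2.1 ∧ 1 ≤ k.2.2.2) ∧
        ¬ (1 ≤ k.2.1 ∧ 1 ≤ k.2.2.1) ∧
        ¬ (1 ≤ k.2.1 ∧ 1 ≤ k.2.2.2) ∧
        ¬ (1 ≤ k.1)} = 4 * r := by
  rw [Nat.subtype_card ((Finset.range 4 ×ˢ Finset.range r).image quadEnum)]
  · rw [Finset.card_image_of_injOn]
    · simp
    · rintro ⟨i, j⟩ h ⟨k, l⟩ hkl e
      simp only [Finset.coe_product, Finset.coe_range, Set.mem_prod, Set.mem_Iio] at h hkl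
      simp only [quadEnum] at e
      split_ifs at e <;> simp only [Prod.mk.injEq] at e ⊢ <;> omega
  · rintro ⟨a, b, c, d⟩
    simp only [Finset.mem_image, Finset.mem_product, Finset.mem_range, Prod.exists]
    constructor
    · rintro ⟨i, j, h, e⟩
      simp only [quadEnum] at e
      split_ifs at e <;> simp only [Prod.mk.injEq] at e <;> omega
    · intro h
      by_cases hb : 1 ≤ b
      · refine ⟨0, b - 1, by omega, ?_⟩
        simp [quadEnum]; omega
      by_cases hd : d = 0
      · by_cases hc : c = 0
        · refine ⟨3, 0, by omega, ?_⟩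
          simp [quadEnum]; omega
        · refine ⟨1, c - 1, by omega, ?_⟩
          simp [quadEnum]; omega
      · by_cases hc : c = 0
        · refine ⟨2, d - 1, by omega, ?_⟩
          simp [quadEnum]; omega
        · refine ⟨3, d, by omega, ?_⟩
          simp [quadEnum, hd]; omega
end

section
/- For every natural number r, the number of pairs (i, (k_x, k_y, k_z, k_t)) with i ∈ {1,…,12} and (k_x, k_y, k_z, k_t) ∈ ℕ⁴ such that k_x + k_y + k_z + k_t ≤ r and: no restriction if 1 ≤ i ≤ 6; k_t = 0 if i ∈ {7, 8, 10, 11}; and k_z = 0 and k_t = 0 if i ∈ {9, 12}; equals (1/4)r⁴ + (19/6)r³ + (55/4)r² + (137/6)r + 12. -/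
/-- Adding one coordinate: the counting function gets summed. -/
theorem card_step {α : Type} (f : α → ℕ) (n : ℕ)
    (h : ∀ r, Finite {x // f x ≤ r} ∧ Nat.card {x // f x ≤ r} = (r + n).choose n) (r : ℕ) :
    Finite {x : ℕ × α // x.1 + f x.2 ≤ r} ∧
      Nat.card {x : ℕ × α // x.1 + f x.2 ≤ r} = (r + (n + 1)).choose (n + 1) := by
  let e : {x : ℕ × α // x.1 + f x.2 ≤ r} ≃ (Σ a : Fin (r + 1), {x // f x ≤ r - a.val}) :=
    { toFun := fun x => ⟨⟨x.1.1, by have := x.2; omega⟩, ⟨x.1.2, by have := x.2; simp only; omega⟩⟩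
      invFun := fun y => ⟨(y.1.val, y.2.1), by have := y.2.2; have := y.1.2; simp only; omega⟩
      left_inv := fun x => rfl
      right_inv := fun y => rfl }
  have hf : ∀ a : Fin (r + 1), Finite {x // f x ≤ r - a.val} := fun a => (h _).1
  refine ⟨Finite.of_equiv _ e.symm, ?_⟩
  rw [Nat.card_congr e, Nat.card_sigma]
  simp only [(h _).2]
  rw [Fin.sum_univ_eq_sum_range (fun a => (r - a + n).choose n) (r + 1)]
  have := Finset.sum_range_reflect (fun a => (a + n).choose n) (r + 1)
  simp only [Nat.add_sub_cancel] at this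
  rw [this, Nat.sum_range_add_choose, add_assoc]

theorem card_one (r : ℕ) : Finite {x : ℕ // x ≤ r} ∧
    Nat.card {x : ℕ // x ≤ r} = (r + 1).choose 1 := by
  let e : {x : ℕ // x ≤ r} ≃ Fin (r + 1) :=
    { toFun := fun x => ⟨x.1, by have := x.2; omega⟩
      invFun := fun y => ⟨y.1, by have := y.2; omega⟩
      left_inv := fun x => rfl
      right_inv := fun y => rfl }
  exact ⟨Finite.of_equiv _ e.symm, by rw [Nat.card_congr e]; simp⟩

theorem card_two (r : ℕ) : Finite {x : ℕ × ℕ // x.1 + x.2 ≤ r} ∧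
    Nat.card {x : ℕ × ℕ // x.1 + x.2 ≤ r} = (r + 2).choose 2 :=
  card_step (fun x : ℕ => x) 1 card_one r

theorem card_three (r : ℕ) : Finite {x : ℕ × ℕ × ℕ // x.1 + (x.2.1 + x.2.2) ≤ r} ∧
    Nat.card {x : ℕ × ℕ × ℕ // x.1 + (x.2.1 + x.2.2) ≤ r} = (r + 3).choose 3 :=
  card_step (fun x : ℕ × ℕ => x.1 + x.2) 2 card_two r

theorem card_four (r : ℕ) : Finite {x : ℕ × ℕ × ℕ × ℕ // x.1 + (x.2.1 + (x.2.2.1 + x.2.2.2)) ≤ r} ∧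
    Nat.card {x : ℕ × ℕ × ℕ × ℕ // x.1 + (x.2.1 + (x.2.2.1 + x.2.2.2)) ≤ r} = (r + 4).choose 4 :=
  card_step (fun x : ℕ × ℕ × ℕ => x.1 + (x.2.1 + x.2.2)) 3 card_three r

theorem choose_two_cast (r : ℕ) : ((r + 2).choose 2 : ℚ) = (r + 1) * (r + 2) / 2 := by
  induction r with
  | zero => simp
  | succ k ih =>
    rw [show k + 1 + 2 = (k + 2) + 1 by ring, Nat.choose_succ_succ' (k + 2) 1]
    push_cast [ih, Nat.choose_one_right]
    ring

theorem choose_three_cast (r : ℕ) :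
    ((r + 3).choose 3 : ℚ) = (r + 1) * (r + 2) * (r + 3) / 6 := by
  induction r with
  | zero => norm_num
  | succ k ih =>
    rw [show k + 1 + 3 = (k + 3) + 1 by ring, Nat.choose_succ_succ' (k + 3) 2]
    have := choose_two_cast (k + 1)
    rw [show k + 1 + 2 = k + 3 by ring] at this
    push_cast [ih, this]
    ring

theorem choose_four_cast (r : ℕ) :
    ((r + 4).choose 4 : ℚ) = (r + 1) * (r + 2) * (r + 3) * (r + 4) / 24 := by
  induction r with
  | zero => norm_num
  | succ k ih =>
    rw [show k + 1 + 4 = (k + 4) + 1 by ring, Nat.choose_succ_succ' (k + 4) 3]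
    have := choose_three_cast (k + 1)
    rw [show k + 1 + 3 = k + 4 by ring] at this
    push_cast [ih, this]
    ring

/-- The restrictions on the exponent vector for the generator `i`. -/
def Irred (r : ℕ) (i : Fin 12) (k : ℕ × ℕ × ℕ × ℕ) : Prop :=
  k.1 + k.2.1 + k.2.2.1 + k.2.2.2 ≤ r ∧
    ((i.val + 1 = 7 ∨ i.val + 1 = 8 ∨ i.val + 1 = 10 ∨ i.val + 1 = 11) → k.2.2.2 = 0) ∧
    ((i.val + 1 = 9 ∨ i.val + 1 = 12) → (k.2.2.1 = 0 ∧ k.2.2.2 = 0))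

theorem irred_finite (r : ℕ) (i : Fin 12) : Finite {k // Irred r i k} := by
  have := (card_four r).1
  refine Finite.of_injective (β := {x : ℕ × ℕ × ℕ × ℕ // x.1 + (x.2.1 + (x.2.2.1 + x.2.2.2)) ≤ r})
    (fun k => ⟨k.1, by have := k.2.1; omega⟩) ?_
  intro a b hab
  exact Subtype.ext (congrArg (fun z => z.1) hab)

theorem irred_free (r : ℕ) (i : Fin 12) (hi : i.val < 6) :
    Nat.card {k // Irred r i k} = (r + 4).choose 4 := by
  rw [← (card_four r).2]
  refine Nat.card_congr (Equiv.subtypeEquivRight fun k => ?_)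
  unfold Irred
  omega

theorem irred_t (r : ℕ) (i : Fin 12)
    (hi : i.val = 6 ∨ i.val = 7 ∨ i.val = 9 ∨ i.val = 10) :
    Nat.card {k // Irred r i k} = (r + 3).choose 3 := by
  rw [← (card_three r).2]
  refine Nat.card_congr
    { toFun := fun k => ⟨(k.1.1, k.1.2.1, k.1.2.2.1), by have := k.2.1; simp only; omega⟩
      invFun := fun k => ⟨(k.1.1, k.1.2.1, k.1.2.2, 0), by
        have := k.2
        exact ⟨by simp only; omega, fun _ => rfl, fun h => by exfalso; omega⟩⟩
      left_inv := ?_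
      right_inv := fun k => rfl }
  rintro ⟨⟨a, b, c, d⟩, h⟩
  have : d = 0 := by unfold Irred at h; simp only at h; omega
  subst this
  rfl

theorem irred_zt (r : ℕ) (i : Fin 12) (hi : i.val = 8 ∨ i.val = 11) :
    Nat.card {k // Irred r i k} = (r + 2).choose 2 := by
  rw [← (card_two r).2]
  refine Nat.card_congr
    { toFun := fun k => ⟨(k.1.1, k.1.2.1), by have := k.2.1; simp only; omega⟩
      invFun := fun k => ⟨(k.1.1, k.1.2, 0, 0), by
        have := k.2
        exact ⟨by simp only; omega, fun _ => rfl, fun _ => ⟨rfl, rfl⟩⟩⟩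
      left_inv := ?_
      right_inv := fun k => rfl }
  rintro ⟨⟨a, b, c, d⟩, h⟩
  have h1 : d = 0 := by unfold Irred at h; simp only at h; omega
  have h2 : c = 0 := by unfold Irred at h; simp only at h; omega
  subst h1 h2
  rfl

/-- The differential dimension polynomial of Maxwell's equations with vanishing
free current and charge densities: the number of pairs `(i, (k_x, k_y, k_z, k_t))`
with `i ∈ {1,…,12}` (encoded as `i : Fin 12` with value `i+1`), total order
`k_x + k_y + k_z + k_t ≤ r`, no restriction for `1 ≤ i ≤ 6`, `k_t = 0` for
`i ∈ {7, 8, 10, 11}`, and `k_z = k_t = 0` for `i ∈ {9, 12}`, equals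
`(1/4)r⁴ + (19/6)r³ + (55/4)r² + (137/6)r + 12`. -/
theorem maxwell_differential_dimension (r : ℕ) :
    (Nat.card {ik : Fin 12 × (ℕ × ℕ × ℕ × ℕ) //
        ik.2.1 + ik.2.2.1 + ik.2.2.2.1 + ik.2.2.2.2 ≤ r ∧
        ((ik.1.val + 1 = 7 ∨ ik.1.val + 1 = 8 ∨ ik.1.val + 1 = 10 ∨ ik.1.val + 1 = 11) →
          ik.2.2.2.2 = 0) ∧
        ((ik.1.val + 1 = 9 ∨ ik.1.val + 1 = 12) →
          (ik.2.2.2.1 = 0 ∧ ik.2.2.2.2 = 0))} : ℚ) =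
      (1 / 4 : ℚ) * r ^ 4 + (19 / 6) * r ^ 3 + (55 / 4) * r ^ 2 + (137 / 6) * r + 12 := by
  have hf := irred_finite r
  let e : {ik : Fin 12 × (ℕ × ℕ × ℕ × ℕ) // Irred r ik.1 ik.2} ≃ (Σ i : Fin 12, {k // Irred r i k}) :=
    { toFun := fun x => ⟨x.1.1, ⟨x.1.2, x.2⟩⟩
      invFun := fun y => ⟨(y.1, y.2.1), y.2.2⟩
      left_inv := fun x => rfl
      right_inv := fun y => rfl }
  have key : Nat.card {ik : Fin 12 × (ℕ × ℕ × ℕ × ℕ) // Irred r ik.1 ik.2} =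
      6 * (r + 4).choose 4 + 4 * (r + 3).choose 3 + 2 * (r + 2).choose 2 := by
    rw [Nat.card_congr e, Nat.card_sigma]
    simp only [Fin.sum_univ_succ, Fin.sum_univ_zero]
    rw [irred_free r _ (by decide), irred_free r _ (by decide), irred_free r _ (by decide),
      irred_free r _ (by decide), irred_free r _ (by decide), irred_free r _ (by decide),
      irred_t r _ (by decide), irred_t r _ (by decide), irred_zt r _ (by decide),
      irred_t r _ (by decide), irred_t r _ (by decide), irred_zt r _ (by decide)]
    ring
  unfold Irred at key
  rw [key]
  push_cast [choose_two_cast, choose_three_cast, choose_four_cast]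
  ring
end

section
/- For every natural number r, the number of pairs (i, (k₁, k₂, k₃, k₄)) with i ∈ {1, 2, 3, 4} and (k₁, k₂, k₃, k₄) ∈ ℕ⁴ such that k₁ + k₂ + k₃ + k₄ ≤ r and: k₁ ≤ 1 if i ∈ {1, 2, 3}; and k₁ ≤ 1 and k₄ = 0 if i = 4; equals r³ + (11/2)r² + (17/2)r + 4. -/
lemma pdd_one (m : ℕ) : (∑ c ∈ Finset.range m, ((m - c : ℕ) : ℚ)) = m * (m + 1) / 2 := by
  induction m with
  | zero => simp
  | succ k ih =>
    rw [Finset.sum_range_succ']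
    simp only [Nat.add_sub_add_right, ih]
    push_cast
    ring

lemma pdd_two (m : ℕ) :
    (∑ b ∈ Finset.range m, ((m - b : ℕ) : ℚ) * (((m - b : ℕ) : ℚ) + 1) / 2)
      = m * (m + 1) * (m + 2) / 6 := by
  induction m with
  | zero => simp
  | succ k ih =>
    rw [Finset.sum_range_succ']
    simp only [Nat.add_sub_add_right, ih]
    push_cast
    ring

/-- The index set, as an iterated dependent sum of ranges. -/
def pddSet (r : ℕ) : Finset (Σ _ : Fin 4, Σ _ : ℕ, Σ _ : ℕ, Σ _ : ℕ, ℕ) :=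
  Finset.univ.sigma fun i => (Finset.range 2).sigma fun a =>
    (Finset.range (r + 1 - a)).sigma fun b => (Finset.range (r + 1 - a - b)).sigma fun c =>
      Finset.range (if i.val = 3 then 1 else r + 1 - a - b - c)

lemma pdd_card (r : ℕ) : ((pddSet r).card : ℚ) =
    r ^ 3 + (11 / 2 : ℚ) * r ^ 2 + (17 / 2) * r + 4 := by
  simp only [pddSet, Finset.card_sigma, Finset.card_range, Fin.sum_univ_four,
    Finset.sum_range_succ (n := 1), Finset.sum_range_one]
  simp [pdd_one, pdd_two]
  ring

/-- The differential dimension polynomial of the equations for an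
electromagnetic field given by its potential: the number of pairs
`(i, (k₁, k₂, k₃, k₄))` with `i ∈ {1, 2, 3, 4}` (encoded as `i : Fin 4` with
value `i+1`), total order `k₁ + k₂ + k₃ + k₄ ≤ r`, `k₁ ≤ 1` for `i ∈ {1, 2, 3}`,
and `k₁ ≤ 1`, `k₄ = 0` for `i = 4`, equals `r³ + (11/2)r² + (17/2)r + 4`. -/
theorem potential_differential_dimension (r : ℕ) :
    (Nat.card {ik : Fin 4 × (ℕ × ℕ × ℕ × ℕ) //
        ik.2.1 + ik.2.2.1 + ik.2.2.2.1 + ik.2.2.2.2 ≤ r ∧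
        (ik.1.val ≤ 2 → ik.2.1 ≤ 1) ∧
        (ik.1.val = 3 → (ik.2.1 ≤ 1 ∧ ik.2.2.2.2 = 0))} : ℚ) =
      r ^ 3 + (11 / 2 : ℚ) * r ^ 2 + (17 / 2) * r + 4 := by
  rw [← pdd_card r]
  congr 1
  rw [← Nat.card_eq_finsetCard]
  refine Nat.card_congr
    { toFun := fun x => ⟨⟨x.1.1, x.1.2.1, x.1.2.2.1, x.1.2.2.2.1, x.1.2.2.2.2⟩, ?_⟩
      invFun := fun y => ⟨(y.1.1, y.1.2.1, y.1.2.2.1, y.1.2.2.2.1, y.1.2.2.2.2), ?_⟩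
      left_inv := fun x => rfl
      right_inv := fun y => rfl }
  · obtain ⟨⟨i, a, b, c, d⟩, h1, h2, h3⟩ := x
    have := i.isLt
    dsimp only at h1 h2 h3
    simp only [pddSet, Finset.mem_sigma, Finset.mem_univ, Finset.mem_range, true_and]
    split_ifs <;> omega
  · obtain ⟨⟨i, a, b, c, d⟩, h⟩ := y
    have := i.isLt
    have h' := h
    simp only [pddSet, Finset.mem_sigma, Finset.mem_univ, Finset.mem_range, true_and] at h'
    dsimp only
    split_ifs at h' <;> omega
end
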